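/- arXiv:2003.12379 — 4 statements merged into one kernel-verified Lean document; each statement's English description precedes it below -/
import Mathlib

section
/- Let G be a Cohen-Macaulay bipartite graph and let w : E(G) → Z_{>0} be an edge weight on G. Then the following conditions are equivalent: (1) the edge-weighted edge ideal I(G_w) is an unmixed ideal; (2) S/I(G_w) is a Cohen-Macaulay ring. -/
universe u

/-- The height of an ideal `p` (intended: a prime ideal), i.e. the Krull dimension of the
set of prime ideals contained in `p`. -/
noncomputable def idealHeight {R : Type*} [CommRing R] (p : Ideal R) : WithBot ℕ∞ :=
  Order.krullDim {q : PrimeSpectrum R // q.asIdeal ≤ p}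

/-- An ideal `I ⊆ R` is unmixed if all associated primes of `R ⧸ I` have the same height. -/
def IsUnmixedIdeal {R : Type*} [CommRing R] (I : Ideal R) : Prop :=
  ∀ p ∈ associatedPrimes R (R ⧸ I), ∀ q ∈ associatedPrimes R (R ⧸ I),
    idealHeight p = idealHeight q

/-- The monomial associated to a weighted edge: `(X u * X v) ^ w(e)` for `e = uv`. -/
noncomputable def edgeMonomial {V : Type*} (K : Type*) [CommSemiring K]
    (w : Sym2 V → ℕ) (e : Sym2 V) : MvPolynomial V K :=
  (Sym2.lift ⟨fun u v => MvPolynomial.X u * MvPolynomial.X v,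
    fun u v => mul_comm _ _⟩ e) ^ w e

/-- The edge-weighted edge ideal `I(G_w)` of an edge-weighted graph `G_w`. -/
noncomputable def weightedEdgeIdeal {V : Type*} (K : Type*) [CommSemiring K]
    (G : SimpleGraph V) (w : Sym2 V → ℕ) : Ideal (MvPolynomial V K) :=
  Ideal.span (edgeMonomial K w '' G.edgeSet)

open CategoryTheory in
/-- The Ext module `Ext_R^n(M, N)`. -/
noncomputable def ExtMod (R : Type u) [CommRing R] (n : ℕ) (M N : Type u)
    [AddCommGroup M] [Module R M] [AddCommGroup N] [Module R N] : ModuleCat R :=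
  ((Ext R (ModuleCat R) n).obj (Opposite.op (ModuleCat.of R M))).obj (ModuleCat.of R N)

/-- The depth of a local ring `R`, defined via vanishing of the Ext modules
`Ext_R^n(k, R)`, where `k` is the residue field of `R`. -/
noncomputable def localRingDepth (R : Type u) [CommRing R] [IsLocalRing R] : ℕ∞ :=
  sInf {n : ℕ∞ | ∃ m : ℕ, n = m ∧
    Nontrivial (ExtMod R m (IsLocalRing.ResidueField R) R)}

/-- A commutative ring is Cohen-Macaulay if for every maximal ideal `p`, the depth of the
localization at `p` equals its Krull dimension. -/
def IsCohenMacaulayRing (R : Type u) [CommRing R] : Prop :=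
  ∀ (p : Ideal R) [p.IsMaximal],
    (localRingDepth (Localization.AtPrime p) : WithBot ℕ∞) =
      ringKrullDim (Localization.AtPrime p)

/-- The (unweighted) edge ideal `I(G)` of a graph, generated by the monomials `X u * X v`
for the edges `uv` of `G`. -/
noncomputable def edgeIdeal {V : Type*} (K : Type*) [CommSemiring K]
    (G : SimpleGraph V) : Ideal (MvPolynomial V K) :=
  Ideal.span ((fun e => Sym2.lift ⟨fun u v => MvPolynomial.X u * MvPolynomial.X v,
    fun u v => mul_comm _ _⟩ e) '' G.edgeSet)

/-- A graph is bipartite if its vertices can be split into two parts such that every edge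
has one endpoint in each part. -/
def IsBipartite {V : Type*} (G : SimpleGraph V) : Prop :=
  ∃ A : Set V, ∀ ⦃u v⦄, G.Adj u v → (u ∈ A ↔ v ∉ A)

/-- A graph has no isolated vertices. -/
def HasNoIsolatedVertices {V : Type*} (G : SimpleGraph V) : Prop :=
  ∀ v, ∃ u, G.Adj v u

section ExtComparison

open CategoryTheory Abelian Limits

universe v w

lemma ProjectiveResolution.subsingleton_ext_iff {R : Type w} [CommRing R] {C : Type*} [Category.{v} C]
    [Abelian C] [Linear R C] [HasExt.{v} C] {X : C} (P : ProjectiveResolution X) (Y : C) (n : ℕ) :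
    Subsingleton (Abelian.Ext.{v} X Y n) ↔ (P.complex.linearYonedaObj R Y).ExactAt n := by
  have key : (P.complex.linearYonedaObj R Y).ExactAt n ↔
      ∀ f : P.complex.X n ⟶ Y, P.complex.d (n + 1) n ≫ f = 0 →
        ∃ g : P.complex.X ((ComplexShape.up ℕ).prev n) ⟶ Y,
          P.complex.d n ((ComplexShape.up ℕ).prev n) ≫ g = f := by
    rw [HomologicalComplex.exactAt_iff' _ ((ComplexShape.up ℕ).prev n) n (n + 1) rfl (by simp),
      ShortComplex.moduleCat_exact_iff]
    rfl
  rw [key]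
  cases n with
  | zero =>
    rw [(Ext.addEquiv₀ (X := X) (Y := Y)).subsingleton_congr]
    constructor
    · intro hs f hf
      refine ⟨0, ?_⟩
      have := P.exact₀
      let φ := this.desc (A := Y) f hf
      have h1 : P.π.f 0 ≫ φ = f := this.g_desc f hf
      have h2 : φ = 0 := @Subsingleton.elim _ hs _ _
      rw [← h1, h2]
      exact comp_zero.trans comp_zero.symm
    · intro h
      refine ⟨fun a b => ?_⟩
      rw [← sub_eq_zero]
      obtain ⟨g, hg⟩ := h (P.π.f 0 ≫ (a - b)) (by
        refine (Category.assoc _ _ _).symm.trans ?_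
        have : P.complex.d (0 + 1) 0 ≫ P.π.f 0 = 0 := P.complex_d_comp_π_f_zero
        exact (congrArg (· ≫ (a - b)) this).trans zero_comp)
      have h0 : P.complex.d 0 ((ComplexShape.up ℕ).prev 0) = 0 := by
        apply P.complex.shape; simp
      rw [h0, zero_comp] at hg
      have : Epi (P.π.f 0) := inferInstance
      exact (cancel_epi (P.π.f 0)).1 (hg.symm.trans comp_zero.symm)
  | succ m =>
    have hp : (ComplexShape.up ℕ).prev (m + 1) = m := by simp
    rw [hp]
    constructor
    · intro hs f hf
      exact (P.extMk_eq_zero_iff f _ rfl hf m rfl).1 (Subsingleton.elim _ _)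
    · intro h
      refine subsingleton_of_forall_eq 0 fun α => ?_
      obtain ⟨f, hf, rfl⟩ := P.extMk_surjective α _ rfl
      exact (P.extMk_eq_zero_iff f _ rfl hf m rfl).2 (h f hf)

end ExtComparison

lemma nontrivial_extMod_iff (R : Type u) [CommRing R] (n : ℕ) (M N : Type u)
    [AddCommGroup M] [Module R M] [AddCommGroup N] [Module R N] :
    Nontrivial (ExtMod R n M N) ↔
      ¬ Subsingleton (CategoryTheory.Abelian.Ext.{u} (ModuleCat.of R M) (ModuleCat.of R N) n) := by
  open CategoryTheory in
  rw [ProjectiveResolution.subsingleton_ext_iff (R := R)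
    (ProjectiveResolution.of (ModuleCat.of R M)),
    HomologicalComplex.exactAt_iff_isZero_homology,
    ← ((ProjectiveResolution.of (ModuleCat.of R M)).isoExt (R := R) n (ModuleCat.of R N)).isZero_iff,
    ModuleCat.isZero_iff_subsingleton, not_subsingleton_iff_nontrivial]
  rfl

section Depth

open CategoryTheory Abelian Limits IsLocalRing

universe w

lemma ext_comp_eq_zero {C : Type*} [Category* C] [Abelian C] [HasExt.{w} C] {X Y Z : C}
    {a b c : ℕ} (hs : Subsingleton (Abelian.Ext.{w} X Y a)) (α : Abelian.Ext.{w} X Y a)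
    (β : Abelian.Ext.{w} Y Z b) (h : a + b = c) : α.comp β h = 0 := by
  rw [@Subsingleton.elim _ hs α 0, Ext.zero_comp]

/-- The short complex of modules attached to an exact pair of linear maps. -/
def modShortComplex {A : Type u} [CommRing A] {M M' M'' : Type u} [AddCommGroup M]
    [Module A M] [AddCommGroup M'] [Module A M'] [AddCommGroup M''] [Module A M'']
    (f : M' →ₗ[A] M) (g : M →ₗ[A] M'') (h : Function.Exact f g) :
    ShortComplex (ModuleCat.{u} A) :=
  ShortComplex.mk (ModuleCat.ofHom f) (ModuleCat.ofHom g) (by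
    ext x
    exact h.apply_apply_eq_zero x)

lemma modShortComplex_shortExact {A : Type u} [CommRing A] {M M' M'' : Type u}
    [AddCommGroup M] [Module A M] [AddCommGroup M'] [Module A M'] [AddCommGroup M''] [Module A M'']
    (f : M' →ₗ[A] M) (g : M →ₗ[A] M'') (h : Function.Exact f g)
    (hf : Function.Injective f) (hg : Function.Surjective g) :
    (modShortComplex f g h).ShortExact where
  exact := (ShortComplex.ShortExact.moduleCat_exact_iff_function_exact _).2 h
  mono_f := (ModuleCat.mono_iff_injective _).2 hf
  epi_g := (ModuleCat.epi_iff_surjective _).2 hg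

/-- The first `n` Ext modules from the residue field into `M` vanish. -/
def DepthGE (A : Type u) [CommRing A] [IsLocalRing A] (M : Type u) [AddCommGroup M] [Module A M]
    (n : ℕ) : Prop :=
  ∀ i < n, Subsingleton
    (CategoryTheory.Abelian.Ext.{u} (ModuleCat.of A (ResidueField A)) (ModuleCat.of A M) i)

variable {A : Type u} [CommRing A] [IsLocalRing A]
variable {M M' M'' : Type u} [AddCommGroup M] [Module A M] [AddCommGroup M'] [Module A M']
  [AddCommGroup M''] [Module A M'']

lemma DepthGE.mono {m n : ℕ} (h : DepthGE A M n) (hmn : m ≤ n) : DepthGE A M m :=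
  fun i hi => h i (hi.trans_le hmn)

lemma DepthGE.of_subsingleton [Subsingleton M] (n : ℕ) : DepthGE A M n := by
  intro i _
  refine subsingleton_of_forall_eq 0 fun α => ?_
  have h : 𝟙 (ModuleCat.of A M) = 0 := by
    ext x
    exact Subsingleton.elim (α := M) _ _
  rw [← Ext.comp_mk₀_id α, h, Ext.mk₀_zero, Ext.comp_zero]

lemma DepthGE.of_exact {n : ℕ} (f : M' →ₗ[A] M) (g : M →ₗ[A] M'') (h : Function.Exact f g)
    (hf : Function.Injective f) (hg : Function.Surjective g)
    (h' : DepthGE A M' n) (h'' : DepthGE A M'' n) : DepthGE A M n := by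
  intro i hi
  have hS := modShortComplex_shortExact f g h hf hg
  refine subsingleton_of_forall_eq 0 fun α => ?_
  obtain ⟨β, rfl⟩ := Ext.covariant_sequence_exact₂ _ hS α
    (@Subsingleton.elim _ (h'' i hi) _ _)
  exact ext_comp_eq_zero (h' i hi) _ _ _

lemma DepthGE.of_equiv {n : ℕ} (e : M ≃ₗ[A] M') (h : DepthGE A M n) : DepthGE A M' n := by
  refine DepthGE.of_exact (M'' := PUnit.{u+1}) e.toLinearMap 0 ?_ e.injective
    (fun x => ⟨0, Subsingleton.elim _ _⟩) h (.of_subsingleton n)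
  intro x
  exact ⟨fun _ => e.surjective x, fun _ => rfl⟩

/-- The cokernel in a short exact sequence loses at most one from the depth of the kernel. -/
lemma DepthGE.of_exact_left {n : ℕ} (f : M' →ₗ[A] M) (g : M →ₗ[A] M'') (h : Function.Exact f g)
    (hf : Function.Injective f) (hg : Function.Surjective g)
    (h' : DepthGE A M' (n + 1)) (hM : DepthGE A M n) : DepthGE A M'' n := by
  intro i hi
  have hS := modShortComplex_shortExact f g h hf hg
  refine subsingleton_of_forall_eq 0 fun α => ?_
  obtain ⟨β, rfl⟩ := Ext.covariant_sequence_exact₃ _ hS α rfl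
    (@Subsingleton.elim _ (h' (i + 1) (by omega)) _ _)
  exact ext_comp_eq_zero (hM i hi) _ _ _

lemma DepthGE.succ_of_regular {n : ℕ} {x : A} (hx : x ∈ maximalIdeal A) (g : M →ₗ[A] M'')
    (h : Function.Exact (LinearMap.lsmul A M x) g)
    (hf : Function.Injective (LinearMap.lsmul A M x)) (hg : Function.Surjective g)
    (h'' : DepthGE A M'' n) : DepthGE A M (n + 1) := by
  intro i hi
  have hS := modShortComplex_shortExact _ g h hf hg
  refine subsingleton_of_forall_eq 0 fun α => ?_
  have hk : x • 𝟙 (ModuleCat.of A (ResidueField A)) = 0 := by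
    ext a
    change x • (a : ResidueField A) = 0
    rw [Algebra.smul_def]
    erw [(residue_eq_zero_iff x).2 hx]
    exact zero_mul _
  have h0 : α.comp (Ext.mk₀ (modShortComplex _ g h).f) (add_zero i) = 0 := by
    have e1 : (modShortComplex (LinearMap.lsmul A M x) g h).f = x • 𝟙 (ModuleCat.of A M) := by
      ext; rfl
    have : x • α = 0 := by
      rw [← Ext.mk₀_id_comp α, ← Ext.smul_comp, ← Ext.mk₀_smul, hk, Ext.mk₀_zero, Ext.zero_comp]
    rw [e1]
    erw [Ext.mk₀_smul, Ext.comp_smul, Ext.comp_mk₀_id]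
    exact this
  cases i with
  | zero =>
    have : Mono (modShortComplex _ g h).f := hS.mono_f
    exact Ext.postcomp_mk₀_injective_of_mono _ (modShortComplex _ g h).f
      (h0.trans (map_zero (Ext.postcomp (Ext.mk₀ (modShortComplex _ g h).f) _ _)).symm)
  | succ j =>
    obtain ⟨β, rfl⟩ := Ext.covariant_sequence_exact₁ _ hS α h0 rfl
    exact ext_comp_eq_zero (h'' j (by omega)) _ _ _

end Depth

lemma le_localRingDepth_of_depthGE {A : Type u} [CommRing A] [IsLocalRing A] {n : ℕ}
    (h : DepthGE A A n) : (n : ℕ∞) ≤ localRingDepth A := by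
  refine le_sInf ?_
  rintro _ ⟨m, rfl, hm⟩
  rw [nontrivial_extMod_iff] at hm
  by_contra hlt
  exact hm (h m (by simpa using hlt))

lemma depthGE_of_le_localRingDepth {A : Type u} [CommRing A] [IsLocalRing A] {n : ℕ}
    (h : (n : ℕ∞) ≤ localRingDepth A) : DepthGE A A n := by
  intro i hi
  by_contra hne
  have := sInf_le (a := (i : ℕ∞)) (s := {n : ℕ∞ | ∃ m : ℕ, n = m ∧
    Nontrivial (ExtMod A m (IsLocalRing.ResidueField A) A)})
    ⟨i, rfl, (nontrivial_extMod_iff _ _ _ _).2 hne⟩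
  have h2 := h.trans this
  rw [Nat.cast_le] at h2
  omega

section DepthBound

open CategoryTheory Abelian IsLocalRing

variable {A : Type u} [CommRing A] [IsLocalRing A]

lemma not_depthGE_one_of_maximalIdeal_mem [IsNoetherianRing A] {M : Type u} [AddCommGroup M]
    [Module A M] (h : maximalIdeal A ∈ associatedPrimes A M) : ¬ DepthGE A M 1 := by
  intro hD
  rw [AssociatedPrimes.mem_iff, isAssociatedPrime_iff_exists_injective_linearMap] at h
  obtain ⟨-, f, hf⟩ := h
  have hs := (Ext.addEquiv₀ (X := ModuleCat.of A (ResidueField A))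
    (Y := ModuleCat.of A M)).subsingleton_congr.1 (hD 0 one_pos)
  have h0 : (ModuleCat.ofHom f : ModuleCat.of A (ResidueField A) ⟶ ModuleCat.of A M) = 0 :=
    Subsingleton.elim _ _
  have h1 : f 1 = 0 := congrArg (fun g => g.hom (1 : ResidueField A)) h0
  exact one_ne_zero (α := ResidueField A) (hf (h1.trans (map_zero f).symm))

lemma Order.coheight_le_of_lt {α : Type*} [Preorder α] {a b : α} {d : ℕ} (hab : a < b)
    (h : Order.coheight a ≤ (d + 1 : ℕ)) : Order.coheight b ≤ d := by
  have h1 := (Order.coheight_add_one_le hab).trans h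
  push_cast at h1
  exact (ENat.add_le_add_iff_right ENat.one_ne_top).1 h1

/-- The depth of a module is at most the coheight of any of its associated primes. -/
theorem not_depthGE_succ_of_coheight_le [IsNoetherianRing A] (d : ℕ) :
    ∀ {M : Type u} [AddCommGroup M] [Module A M] [Module.Finite A M] (P : PrimeSpectrum A),
      P.asIdeal ∈ associatedPrimes A M → Order.coheight P ≤ d → ¬ DepthGE A M (d + 1) := by
  induction d with
  | zero =>
    intro M _ _ _ P hP hd
    have hmax : P = closedPoint A := by
      have : IsMax P := Order.coheight_eq_zero.1 (by simpa using hd)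
      exact this.eq_of_le (le_maximalIdeal P.2.ne_top)
    rw [hmax] at hP
    exact not_depthGE_one_of_maximalIdeal_mem hP
  | succ d ih =>
    intro M _ _ _ P hP hd hD
    by_cases hmax : maximalIdeal A ∈ associatedPrimes A M
    · exact not_depthGE_one_of_maximalIdeal_mem hmax (hD.mono (by omega))
    obtain ⟨x, hx, hreg⟩ : ∃ x ∈ maximalIdeal A, ∀ m : M, x • m = 0 → m = 0 := by
      by_contra! hcon
      have hsub : (maximalIdeal A : Set A) ⊆ ⋃ p ∈ associatedPrimes A M, (p : Set A) := by
        rw [biUnion_associatedPrimes_eq_zero_divisors]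
        intro x hx
        obtain ⟨m, hm, hm0⟩ := hcon x hx
        exact ⟨m, hm0, hm⟩
      obtain ⟨Q, hQ, hle⟩ := ((maximalIdeal A).subset_union_prime_finite
        (associatedPrimes.finite A M) (f := id) 0 0 fun _ h _ _ ↦ h.1).1 hsub
      have := (maximalIdeal.isMaximal A).eq_of_le hQ.1.ne_top hle
      exact hmax (this ▸ hQ)
    obtain ⟨hPp, m₀, hm₀⟩ := isAssociatedPrime_iff.1 hP
    have hmem : ∀ a, a ∈ P.asIdeal ↔ a • m₀ = 0 := fun a => by
      rw [hm₀, Submodule.mem_colon_singleton, Submodule.mem_bot]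
    have hxP : x ∉ P.asIdeal := fun h => hPp.ne_top <| by
      rw [Ideal.eq_top_iff_one, hmem, hreg m₀ ((hmem x).1 h), smul_zero]
    let N : Submodule A M := Submodule.torsionBySet A M P.asIdeal
    have hN : ∀ m, m ∈ N ↔ ∀ a ∈ P.asIdeal, a • m = 0 := fun m => by
      simp [N, Submodule.mem_torsionBySet_iff]
    obtain ⟨m, hmN, hmx⟩ : ∃ m ∈ N, m ∉ LinearMap.range (LinearMap.lsmul A M x) := by
      by_contra! hcon
      have hbot : N = ⊥ := by
        refine Submodule.eq_bot_of_le_smul_of_le_jacobson_bot (maximalIdeal A) N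
          (IsNoetherian.noetherian N) ?_ (maximalIdeal_le_jacobson _)
        intro m hm
        obtain ⟨m', rfl⟩ := hcon m hm
        refine Submodule.smul_mem_smul hx ((hN _).2 fun a ha => hreg _ ?_)
        rw [smul_comm]
        exact (hN _).1 hm a ha
      have : m₀ ∈ N := (hN _).2 fun a ha => (hmem a).1 ha
      rw [hbot, Submodule.mem_bot] at this
      exact hxP ((hmem x).2 (by rw [this, smul_zero]))
    let q := (LinearMap.range (LinearMap.lsmul A M x)).mkQ
    have hqm : q m ≠ 0 := by
      rw [Ne, Submodule.mkQ_apply, Submodule.Quotient.mk_eq_zero]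
      exact hmx
    obtain ⟨Q, hQ, hle⟩ := exists_le_isAssociatedPrime_of_isNoetherianRing A (q m) hqm
    have hmemQ : ∀ a, a • q m = 0 → a ∈ Q := fun a ha =>
      hle (Submodule.mem_colon_singleton.2 ha)
    have hxQ : x ∈ Q := hmemQ x <| by
      rw [← map_smul, Submodule.mkQ_apply, Submodule.Quotient.mk_eq_zero]
      exact ⟨m, rfl⟩
    have hPQ : P < ⟨Q, hQ.1⟩ := by
      refine lt_of_le_of_ne (fun a ha => hmemQ a ?_) fun h => hxP ?_
      · rw [← map_smul, (hN m).1 hmN a ha, map_zero]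
      · rw [h]; exact hxQ
    refine ih (M := M ⧸ LinearMap.range (LinearMap.lsmul A M x)) ⟨Q, hQ.1⟩ hQ
      (Order.coheight_le_of_lt hPQ hd) ?_
    refine DepthGE.of_exact_left (LinearMap.lsmul A M x) q (fun y => ?_) ?_
      (Submodule.mkQ_surjective _) hD (hD.mono (by omega))
    · rw [← LinearMap.mem_ker, Submodule.ker_mkQ]
      rfl
    · rw [injective_iff_map_eq_zero]
      exact hreg

end DepthBound

section VarIdeal

open MvPolynomial

variable {V K : Type*} [Field K]

/-- The prime ideal generated by a set of variables. -/
noncomputable def varIdeal (K : Type*) [Field K] (C : Finset V) : Ideal (MvPolynomial V K) :=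
  Ideal.span (X '' (C : Set V))

lemma X_mem_varIdeal {C : Finset V} {v : V} (hv : v ∈ C) : X v ∈ varIdeal K C :=
  Ideal.subset_span ⟨v, hv, rfl⟩

lemma varIdeal_le {C : Finset V} {I : Ideal (MvPolynomial V K)} :
    varIdeal K C ≤ I ↔ ∀ v ∈ C, X v ∈ I := by
  rw [varIdeal, Ideal.span_le]
  exact ⟨fun h v hv => h ⟨v, hv, rfl⟩, by rintro h _ ⟨v, hv, rfl⟩; exact h v hv⟩

lemma varIdeal_mono {C D : Finset V} (h : C ⊆ D) : varIdeal K C ≤ varIdeal K D :=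
  varIdeal_le.2 fun _ hv => X_mem_varIdeal (h hv)

variable (K) in
lemma varIdeal_eq_ker [DecidableEq V] (C : Finset V) : varIdeal K C =
    RingHom.ker (aeval (fun v => if v ∈ C then (0 : MvPolynomial V K) else X v)) := by
  set ψ : MvPolynomial V K →ₐ[K] MvPolynomial V K :=
    aeval (fun v => if v ∈ C then (0 : MvPolynomial V K) else X v)
  apply le_antisymm
  · rw [varIdeal_le]
    intro v hv
    simp [ψ, RingHom.mem_ker, hv]
  · intro f hf
    have key : (Ideal.Quotient.mkₐ K (varIdeal K C)).comp ψ = Ideal.Quotient.mkₐ K _ := by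
      ext v
      by_cases hv : v ∈ C
      · simpa [ψ, hv] using (Ideal.Quotient.eq_zero_iff_mem.2 (X_mem_varIdeal hv)).symm
      · simp [ψ, hv]
    have h1 := DFunLike.congr_fun key f
    rw [AlgHom.comp_apply, (RingHom.mem_ker).1 hf, map_zero] at h1
    exact Ideal.Quotient.eq_zero_iff_mem.1 h1.symm

lemma isPrime_varIdeal (C : Finset V) : (varIdeal K C).IsPrime := by
  classical
  rw [varIdeal_eq_ker]
  exact RingHom.ker_isPrime _

lemma X_mem_varIdeal_iff {C : Finset V} {v : V} : X v ∈ varIdeal K C ↔ v ∈ C := by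
  classical
  refine ⟨fun h => ?_, X_mem_varIdeal⟩
  by_contra hv
  rw [varIdeal_eq_ker, RingHom.mem_ker, aeval_X, if_neg hv] at h
  exact X_ne_zero v h

/-- The ideal `varIdeal K C` as a point of the spectrum. -/
noncomputable def varPrime (K : Type*) [Field K] (C : Finset V) :
    PrimeSpectrum (MvPolynomial V K) := ⟨varIdeal K C, isPrime_varIdeal C⟩

lemma varPrime_lt {C D : Finset V} (h : C ⊂ D) : varPrime K C < varPrime K D := by
  refine lt_of_le_of_ne (varIdeal_mono h.1) fun e => h.2 fun v hv => ?_
  have e' : varIdeal K C = varIdeal K D := congrArg PrimeSpectrum.asIdeal e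
  rwa [← X_mem_varIdeal_iff (K := K), e', X_mem_varIdeal_iff]

variable (K) in
lemma card_le_height_varPrime (C : Finset V) : (C.card : ℕ∞) ≤ Order.height (varPrime K C) := by
  classical
  induction C using Finset.induction_on with
  | empty => simp
  | insert v C hv ih =>
    rw [Finset.card_insert_of_notMem hv, Nat.cast_add, Nat.cast_one]
    exact (add_le_add_left ih 1).trans (Order.height_add_one_le (varPrime_lt (Finset.ssubset_insert hv)))

/-- Induction for the coheight of the primes `varPrime K C` in a poset mapping to the spectrum. -/
lemma card_le_coheight_add [Fintype V] {α : Type*} [Preorder α] (f : Finset V → α)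
    (C₀ : Finset V)
    (hf : ∀ C D, C₀ ⊆ C → C ⊂ D → f C < f D) :
    (Fintype.card V : ℕ∞) ≤ Order.coheight (f C₀) + C₀.card := by
  classical
  have key : ∀ k : ℕ, ∀ C, C₀ ⊆ C → C.card + k = Fintype.card V →
      (k : ℕ∞) ≤ Order.coheight (f C) := by
    intro k
    induction k with
    | zero => simp
    | succ k ih =>
      intro C hC hk
      obtain ⟨v, hv⟩ : ∃ v, v ∉ C := by
        by_contra! hcon
        rw [Finset.eq_univ_iff_forall.2 hcon, Finset.card_univ] at hk
        omega
      have h1 := ih (insert v C) (hC.trans (Finset.subset_insert _ _))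
        (by rw [Finset.card_insert_of_notMem hv]; omega)
      rw [Nat.cast_add, Nat.cast_one]
      exact (add_le_add_left h1 1).trans (Order.coheight_add_one_le (hf C _ hC (Finset.ssubset_insert hv)))
  have hle := Finset.card_le_univ C₀
  have := key (Fintype.card V - C₀.card) C₀ subset_rfl (by omega)
  calc (Fintype.card V : ℕ∞) = ((Fintype.card V - C₀.card : ℕ) : ℕ∞) + C₀.card := by
        norm_cast; omega
    _ ≤ _ := add_le_add_left this _

variable (K) in
lemma card_le_coheight_varPrime_add [Fintype V] (C : Finset V) :
    (Fintype.card V : ℕ∞) ≤ Order.coheight (varPrime K C) + C.card := by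
  refine card_le_coheight_add (varPrime K) C ?_
  exact fun C D _ h => varPrime_lt h

lemma height_add_coheight_le_card [Fintype V] (P : PrimeSpectrum (MvPolynomial V K)) :
    Order.height P + Order.coheight P ≤ Fintype.card V := by
  have h := MvPolynomial.ringKrullDim_of_isNoetherianRing (R := K) (ι := V)
  rw [ringKrullDim_eq_zero_of_field, zero_add, ringKrullDim,
    Order.krullDim_eq_iSup_height_add_coheight_of_nonempty, Nat.card_eq_fintype_card] at h
  have h2 : (⨆ a : PrimeSpectrum (MvPolynomial V K), Order.height a + Order.coheight a) =
    (Fintype.card V : ℕ∞) := by exact_mod_cast h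
  rw [← h2]
  exact le_iSup (fun a => Order.height a + Order.coheight a) P

lemma coheight_add_card_le [Fintype V] (P : PrimeSpectrum (MvPolynomial V K)) {C : Finset V}
    (h : ∀ v ∈ C, X v ∈ P.asIdeal) : Order.coheight P + C.card ≤ Fintype.card V := by
  have h1 : varPrime K C ≤ P := varIdeal_le.2 h
  refine le_trans ?_ (height_add_coheight_le_card P)
  rw [add_comm]
  exact add_le_add_left ((card_le_height_varPrime K C).trans (Order.height_mono h1)) _

lemma height_varPrime [Fintype V] (C : Finset V) : Order.height (varPrime K C) = C.card := by
  refine le_antisymm ?_ (card_le_height_varPrime K C)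
  have h1 := card_le_coheight_varPrime_add K C
  have h2 := height_add_coheight_le_card (varPrime K C)
  have h3 := h2.trans h1
  have : Order.coheight (varPrime K C) ≠ ⊤ := by
    intro htop
    rw [htop, add_top] at h2
    exact absurd h2 (by simp)
  rw [add_comm] at h3
  exact (ENat.add_le_add_iff_left this).1 h3

lemma idealHeight_eq {R : Type*} [CommRing R] (P : PrimeSpectrum R) :
    idealHeight P.asIdeal = Order.height P := by
  rw [Order.height_eq_krullDim_Iic]
  rfl

end VarIdeal

section LocQuot

variable {S A : Type*} [CommRing S] [CommRing A]

/-- `φ : S → A` exhibits `A` as the localization of `S ⧸ J` at the prime ideal `q` of `S`. -/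
structure IsLocQuot (J q : Ideal S) (φ : S →+* A) : Prop where
  apply_eq_zero : ∀ s ∈ J, φ s = 0
  exists_mul_mem : ∀ s, φ s = 0 → ∃ t ∉ q, t * s ∈ J
  surj : ∀ a, ∃ s, ∃ t ∉ q, a * φ t = φ s
  isUnit_iff : ∀ t, IsUnit (φ t) ↔ t ∉ q

lemma isLocQuot_atPrime (J : Ideal S) (p : Ideal (S ⧸ J)) [p.IsPrime] :
    IsLocQuot J (p.comap (Ideal.Quotient.mk J))
      ((algebraMap (S ⧸ J) (Localization.AtPrime p)).comp (Ideal.Quotient.mk J)) where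
  apply_eq_zero s hs := by
    rw [RingHom.comp_apply, Ideal.Quotient.eq_zero_iff_mem.2 hs, map_zero]
  exists_mul_mem s hs := by
    obtain ⟨⟨t, ht⟩, h⟩ := (IsLocalization.map_eq_zero_iff p.primeCompl _ _).1 hs
    obtain ⟨t, rfl⟩ := Ideal.Quotient.mk_surjective t
    refine ⟨t, ht, ?_⟩
    rw [← Ideal.Quotient.eq_zero_iff_mem, map_mul]
    exact h
  surj a := by
    obtain ⟨⟨s, t, ht⟩, h⟩ := IsLocalization.surj p.primeCompl a
    obtain ⟨t, rfl⟩ := Ideal.Quotient.mk_surjective t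
    obtain ⟨s, rfl⟩ := Ideal.Quotient.mk_surjective s
    exact ⟨s, t, ht, h⟩
  isUnit_iff t := IsLocalization.AtPrime.isUnit_to_map_iff (Localization.AtPrime p) p _

namespace IsLocQuot

variable {J q : Ideal S} {φ : S →+* A} (h : IsLocQuot J q φ)

include h

lemma mul_notMem {s t : S} (hs : s ∉ q) (ht : t ∉ q) : s * t ∉ q := by
  rw [← h.isUnit_iff, map_mul]
  exact ((h.isUnit_iff s).2 hs).mul ((h.isUnit_iff t).2 ht)

lemma one_notMem : (1 : S) ∉ q := by
  rw [← h.isUnit_iff, map_one]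
  exact isUnit_one

lemma mem_map_iff {J' : Ideal S} {a : A} :
    a ∈ J'.map φ ↔ ∃ s ∈ J', ∃ t ∉ q, a * φ t = φ s := by
  constructor
  · intro ha
    refine Submodule.span_induction ?_ ?_ ?_ ?_ ha
    · rintro _ ⟨s, hs, rfl⟩
      exact ⟨s, hs, 1, h.one_notMem, by simp⟩
    · exact ⟨0, zero_mem _, 1, h.one_notMem, by simp⟩
    · rintro a b - - ⟨s, hs, t, ht, e⟩ ⟨s', hs', t', ht', e'⟩
      refine ⟨s * t' + s' * t, add_mem (J'.mul_mem_right _ hs) (J'.mul_mem_right _ hs'),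
        t * t', h.mul_notMem ht ht', ?_⟩
      rw [map_mul, map_add, map_mul, map_mul, ← e, ← e']
      ring
    · rintro b a - ⟨s, hs, t, ht, e⟩
      obtain ⟨s', t', ht', e'⟩ := h.surj b
      refine ⟨s' * s, J'.mul_mem_left _ hs, t' * t, h.mul_notMem ht' ht, ?_⟩
      rw [smul_eq_mul, map_mul, map_mul, ← e, ← e']
      ring
  · rintro ⟨s, hs, t, ht, e⟩
    rw [← Ideal.mul_unit_mem_iff_mem _ ((h.isUnit_iff t).2 ht), e]
    exact Ideal.mem_map_of_mem φ hs

lemma apply_mem_map_iff {J' : Ideal S} (hJ : J ≤ J') {s : S} :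
    φ s ∈ J'.map φ ↔ ∃ t ∉ q, t * s ∈ J' := by
  rw [h.mem_map_iff]
  constructor
  · rintro ⟨s', hs', t, ht, e⟩
    obtain ⟨t', ht', h0⟩ := h.exists_mul_mem (s * t - s') (by rw [map_sub, map_mul, e, sub_self])
    refine ⟨t' * t, h.mul_notMem ht' ht, ?_⟩
    have := add_mem (hJ h0) (J'.mul_mem_left t' hs')
    convert this using 1
    ring
  · rintro ⟨t, ht, hs⟩
    exact ⟨t * s, hs, t, ht, by rw [map_mul, mul_comm]⟩

lemma map_comap (P : Ideal A) : (P.comap φ).map φ = P := by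
  refine le_antisymm Ideal.map_comap_le fun a ha => ?_
  obtain ⟨s, t, ht, e⟩ := h.surj a
  rw [h.mem_map_iff]
  exact ⟨s, by rw [Ideal.mem_comap, ← e]; exact P.mul_mem_right _ ha, t, ht, e⟩

lemma comap_strictMono : StrictMono (PrimeSpectrum.comap φ) := by
  intro P Q hPQ
  refine lt_of_le_of_ne (Ideal.comap_mono hPQ.le) fun e => hPQ.ne ?_
  ext1
  have e' : P.asIdeal.comap φ = Q.asIdeal.comap φ := congrArg PrimeSpectrum.asIdeal e
  rw [← h.map_comap P.asIdeal, e', h.map_comap]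

lemma le_comap (P : Ideal A) : J ≤ P.comap φ := fun s hs => by
  rw [Ideal.mem_comap, h.apply_eq_zero s hs]
  exact zero_mem P

lemma comap_le (P : PrimeSpectrum A) : P.asIdeal.comap φ ≤ q := fun t ht => by
  by_contra hq
  exact P.2.ne_top (P.asIdeal.eq_top_of_isUnit_mem ht ((h.isUnit_iff t).2 hq))

lemma comap_map {P : Ideal S} (hP : P.IsPrime) (hJ : J ≤ P) (hq : P ≤ q) :
    (P.map φ).comap φ = P := by
  refine le_antisymm (fun s hs => ?_) Ideal.le_comap_map
  rw [Ideal.mem_comap, h.apply_mem_map_iff hJ] at hs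
  obtain ⟨t, ht, hts⟩ := hs
  exact (hP.mem_or_mem hts).resolve_left fun h' => ht (hq h')

lemma isPrime_map {P : Ideal S} (hP : P.IsPrime) (hJ : J ≤ P) (hq : P ≤ q) :
    (P.map φ).IsPrime := by
  have hcm := h.comap_map hP hJ hq
  refine ⟨fun htop => hP.ne_top ?_, fun {a b} hab => ?_⟩
  · rw [← hcm, htop, Ideal.comap_top]
  · obtain ⟨s, t, ht, e⟩ := h.surj a
    obtain ⟨s', t', ht', e'⟩ := h.surj b
    have h1 : s * s' ∈ P := by
      rw [← hcm, Ideal.mem_comap, map_mul, ← e, ← e']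
      have := Ideal.mul_mem_right (φ t * φ t') _ hab
      convert this using 1
      ring
    exact (hP.mem_or_mem h1).imp (fun hs => h.mem_map_iff.2 ⟨s, hs, t, ht, e⟩)
      fun hs => h.mem_map_iff.2 ⟨s', hs, t', ht', e'⟩

lemma map_lt_map {P Q : PrimeSpectrum S} (hPQ : P < Q) (hJ : J ≤ P.asIdeal) (hq : Q.asIdeal ≤ q) :
    (⟨P.asIdeal.map φ, h.isPrime_map P.2 hJ (le_trans (show P.asIdeal ≤ _ from hPQ.le) hq)⟩ :
      PrimeSpectrum A) <
      ⟨Q.asIdeal.map φ, h.isPrime_map Q.2 (hJ.trans hPQ.le) hq⟩ := by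
  refine lt_of_le_of_ne (Ideal.map_mono hPQ.le) fun e => hPQ.ne ?_
  have e' : P.asIdeal.map φ = Q.asIdeal.map φ := congrArg PrimeSpectrum.asIdeal e
  ext1
  rw [← h.comap_map P.2 hJ (le_trans (show P.asIdeal ≤ _ from hPQ.le) hq), e',
    h.comap_map Q.2 (hJ.trans hPQ.le) hq]

/-- Associated primes of `S ⧸ J` contained in `q` extend to associated primes of `A`. -/
lemma map_mem_associatedPrimes [IsNoetherianRing S] [IsNoetherianRing A] {P : Ideal S}
    (hP : P ∈ associatedPrimes S (S ⧸ J)) (hq : P ≤ q) : P.map φ ∈ associatedPrimes A A := by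
  obtain ⟨hPp, x, hx⟩ := isAssociatedPrime_iff.1 hP
  obtain ⟨f, rfl⟩ := Ideal.Quotient.mk_surjective x
  have hmem : ∀ s, s ∈ P ↔ s * f ∈ J := fun s => by
    rw [hx, Submodule.mem_colon_singleton, Submodule.mem_bot, Algebra.smul_def,
      Ideal.Quotient.algebraMap_eq, ← map_mul, Ideal.Quotient.eq_zero_iff_mem]
  have hJ : J ≤ P := fun s hs => (hmem s).2 (J.mul_mem_right _ hs)
  rw [AssociatedPrimes.mem_iff, isAssociatedPrime_iff]
  refine ⟨h.isPrime_map hPp hJ hq, φ f, ?_⟩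
  ext a
  obtain ⟨s, t, ht, e⟩ := h.surj a
  rw [Submodule.mem_colon_singleton, Submodule.mem_bot, smul_eq_mul,
    ← Ideal.mul_unit_mem_iff_mem _ ((h.isUnit_iff t).2 ht), e, ← Ideal.mem_comap,
    h.comap_map hPp hJ hq, hmem]
  constructor
  · intro h0
    rw [← ((h.isUnit_iff t).2 ht).mul_left_inj, zero_mul, mul_right_comm, e, ← map_mul]
    exact h.apply_eq_zero _ h0
  · intro h0
    obtain ⟨t', ht', h1⟩ := h.exists_mul_mem (s * f)
      (by rw [map_mul, ← e, mul_right_comm, h0, zero_mul])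
    rw [← mul_assoc, ← hmem] at h1
    rw [← hmem]
    exact (hPp.mem_or_mem h1).resolve_left fun h' => ht' (hq h')

end IsLocQuot

end LocQuot

section LocalDimension

open MvPolynomial IsLocalRing

lemma DepthGE.le_coheight {A : Type u} [CommRing A] [IsLocalRing A] [IsNoetherianRing A]
    {M : Type u} [AddCommGroup M] [Module A M] [Module.Finite A M] {d : ℕ} (hD : DepthGE A M d)
    {P : PrimeSpectrum A} (hP : P.asIdeal ∈ associatedPrimes A M) : (d : ℕ∞) ≤ Order.coheight P := by
  by_contra! hlt
  obtain ⟨c, hc⟩ := ENat.ne_top_iff_exists.1 hlt.ne_top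
  rw [← hc, Nat.cast_lt] at hlt
  exact not_depthGE_succ_of_coheight_le c P hP hc.ge (hD.mono hlt)

/-- A Cohen-Macaulay local ring, with its dimension as a natural number. -/
lemma exists_depthGE_of_depth_eq {A : Type u} [CommRing A] [IsLocalRing A] [IsNoetherianRing A]
    (hCM : (localRingDepth A : WithBot ℕ∞) = ringKrullDim A) :
    ∃ d : ℕ, ringKrullDim A = d ∧ DepthGE A A d := by
  obtain ⟨d, hd⟩ : ∃ d : ℕ, localRingDepth A = d := by
    have : localRingDepth A ≠ ⊤ := fun h => by
      rw [h] at hCM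
      exact (ringKrullDim_lt_top (R := A)).ne hCM.symm
    exact (ENat.ne_top_iff_exists.1 this).imp fun _ h => h.symm
  exact ⟨d, by rw [← hCM, hd]; rfl, depthGE_of_le_localRingDepth hd.ge⟩

/-- If the depth is at least `n` and the dimension at most `n` then they agree. -/
lemma depth_eq_of_depthGE {A : Type u} [CommRing A] [IsLocalRing A] [IsNoetherianRing A] {n : ℕ}
    (hD : DepthGE A A n) (hd : ringKrullDim A ≤ n) :
    (localRingDepth A : WithBot ℕ∞) = ringKrullDim A := by
  obtain ⟨P, hP⟩ := associatedPrimes.nonempty A A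
  have key : ∀ d : ℕ, DepthGE A A d → (d : WithBot ℕ∞) ≤ ringKrullDim A := fun d h =>
    le_trans (by exact_mod_cast h.le_coheight (P := ⟨P, hP.1⟩) hP) (Order.coheight_le_krullDim _)
  have hn := le_antisymm hd (key n hD)
  rw [hn]
  refine le_antisymm ?_ (by exact_mod_cast le_localRingDepth_of_depthGE hD)
  by_contra! hlt
  have hlt' : (n : ℕ∞) < localRingDepth A := by exact_mod_cast hlt
  have h1 := key (n + 1) (depthGE_of_le_localRingDepth (by
    rw [Nat.cast_add, Nat.cast_one]
    exact Order.add_one_le_of_lt hlt'))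
  rw [hn] at h1
  have : n + 1 ≤ n := by exact_mod_cast h1
  omega

variable {V K : Type u} [Field K] [Fintype V] {A : Type u} [CommRing A]
  {J q : Ideal (MvPolynomial V K)} {φ : MvPolynomial V K →+* A}

namespace IsLocQuot

variable (h : IsLocQuot J q φ)

include h

lemma coheight_add_card_le (P : PrimeSpectrum A) {B : Finset V}
    (hB : ∀ v ∈ B, φ (X v) ∈ P.asIdeal) : Order.coheight P + B.card ≤ Fintype.card V :=
  (add_le_add_left (Order.coheight_le_coheight_apply_of_strictMono _ h.comap_strictMono P) _).trans
    (_root_.coheight_add_card_le _ hB)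

lemma card_le_coheight_add (hq : ∀ v, X v ∈ q) {C : Finset V} (hC : J ≤ varIdeal K C)
    (P : PrimeSpectrum A) (hP : P.asIdeal = (varIdeal K C).map φ) :
    (Fintype.card V : ℕ∞) ≤ Order.coheight P + C.card := by
  classical
  have hq' : ∀ C, varIdeal K C ≤ q := fun C => varIdeal_le.2 fun v _ => hq v
  let f : Finset V → PrimeSpectrum A := fun D =>
    if hD : C ⊆ D then ⟨(varIdeal K D).map φ,
      h.isPrime_map (isPrime_varIdeal D) (hC.trans (varIdeal_mono hD)) (hq' D)⟩ else P
  have hf : f C = P := by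
    ext1
    simp [f, hP]
  rw [← hf]
  refine _root_.card_le_coheight_add f C ?_
  intro D E hD hDE
  simp only [f, dif_pos hD, dif_pos (hD.trans hDE.1)]
  exact h.map_lt_map (varPrime_lt hDE) (hC.trans (varIdeal_mono hD)) (hq' _)

lemma card_le_ringKrullDim_add (hq : ∀ v, X v ∈ q) {C : Finset V} (hC : J ≤ varIdeal K C) :
    (Fintype.card V : WithBot ℕ∞) ≤ ringKrullDim A + C.card := by
  have h1 := h.card_le_coheight_add hq hC
    ⟨_, h.isPrime_map (isPrime_varIdeal C) hC (varIdeal_le.2 fun v _ => hq v)⟩ rfl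
  refine le_trans (b := ((Order.coheight _ + C.card : ℕ∞) : WithBot ℕ∞)) (by exact_mod_cast h1) ?_
  rw [WithBot.coe_add]
  exact add_le_add_left (Order.coheight_le_krullDim _) _

lemma ringKrullDim_le {n : ℕ} (hn : ∀ P : Ideal (MvPolynomial V K), P.IsPrime → J ≤ P →
    ∃ B : Finset V, (∀ v ∈ B, X v ∈ P) ∧ Fintype.card V ≤ n + B.card) : ringKrullDim A ≤ n := by
  rw [ringKrullDim, Order.krullDim_eq_iSup_coheight]
  refine iSup_le fun P => ?_
  obtain ⟨B, hB, hc⟩ := hn (P.asIdeal.comap φ) (P.2.comap φ) (h.le_comap _)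
  have h1 := (h.coheight_add_card_le P hB).trans (Nat.cast_le.2 hc)
  rw [Nat.cast_add] at h1
  exact_mod_cast (ENat.add_le_add_iff_right (ENat.natCast_ne_top _)).1 h1

variable [IsLocalRing A] [IsNoetherianRing A]

lemma card_le_card_add {M : Type u} [AddCommGroup M] [Module A M] [Module.Finite A M]
    (hq : ∀ v, X v ∈ q) {d k : ℕ} (hd : ringKrullDim A ≤ (d + k : ℕ)) (hD : DepthGE A M d)
    {C : Finset V} (hC : J ≤ varIdeal K C) {P : Ideal A} (hP : P ∈ associatedPrimes A M)
    {B : Finset V} (hB : ∀ v ∈ B, φ (X v) ∈ P) : B.card ≤ C.card + k := by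
  have h1 := hD.le_coheight (P := ⟨P, hP.1⟩) hP
  have h2 := h.coheight_add_card_le ⟨P, hP.1⟩ hB
  have h3 := (h.card_le_ringKrullDim_add hq hC).trans (add_le_add_left hd _)
  have h4 : Fintype.card V ≤ d + k + C.card := by exact_mod_cast h3
  have h5 := (add_le_add_left h1 (B.card : ℕ∞)).trans h2
  have h6 : d + B.card ≤ Fintype.card V := by exact_mod_cast h5
  omega

end IsLocQuot

end LocalDimension

section CohenMacaulayLocal

open MvPolynomial

/-- At a maximal ideal containing `J`, a Cohen-Macaulay quotient `S ⧸ J` has a local ring whose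
depth is its dimension. -/
lemma IsCohenMacaulayRing.exists_isLocQuot {S : Type u} [CommRing S] [IsNoetherianRing S]
    {J : Ideal S} (hCM : IsCohenMacaulayRing (S ⧸ J)) {q : Ideal S} (hq : q.IsMaximal)
    (hJ : J ≤ q) :
    ∃ (A : Type u) (_ : CommRing A) (_ : IsLocalRing A) (_ : IsNoetherianRing A) (φ : S →+* A),
      IsLocQuot J q φ ∧ ∃ d : ℕ, ringKrullDim A = d ∧ DepthGE A A d := by
  have hcomap : (q.map (Ideal.Quotient.mk J)).comap (Ideal.Quotient.mk J) = q := by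
    rw [Ideal.comap_map_of_surjective _ Ideal.Quotient.mk_surjective, sup_eq_left,
      ← RingHom.ker_eq_comap_bot, Ideal.mk_ker]
    exact hJ
  have hmax : (q.map (Ideal.Quotient.mk J)).IsMaximal := by
    refine (Ideal.map_eq_top_or_isMaximal_of_surjective _ Ideal.Quotient.mk_surjective hq).resolve_left
      fun h => hq.ne_top ?_
    rw [← hcomap, h, Ideal.comap_top]
  have hloc := isLocQuot_atPrime J (q.map (Ideal.Quotient.mk J))
  rw [hcomap] at hloc
  have hN : IsNoetherianRing (Localization.AtPrime (q.map (Ideal.Quotient.mk J))) :=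
    IsLocalization.isNoetherianRing (q.map (Ideal.Quotient.mk J)).primeCompl _ inferInstance
  exact ⟨_, inferInstance, inferInstance, hN, _, hloc, exists_depthGE_of_depth_eq (hCM _)⟩

lemma isMaximal_ker_constantCoeff (V K : Type*) [Field K] :
    (RingHom.ker (constantCoeff : MvPolynomial V K →+* K)).IsMaximal :=
  RingHom.ker_isMaximal_of_surjective _ fun a => ⟨C a, constantCoeff_C V a⟩

end CohenMacaulayLocal

section EdgeIdeal

open MvPolynomial

variable {V K : Type*} [Field K] {G : SimpleGraph V}

lemma X_mul_X_mem_edgeIdeal {u v : V} (h : G.Adj u v) :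
    (X u * X v : MvPolynomial V K) ∈ edgeIdeal K G :=
  Ideal.subset_span ⟨s(u, v), h, rfl⟩

lemma edgeIdeal_le {I : Ideal (MvPolynomial V K)} :
    edgeIdeal K G ≤ I ↔ ∀ u v, G.Adj u v → X u * X v ∈ I := by
  rw [edgeIdeal, Ideal.span_le]
  constructor
  · exact fun h u v huv => h ⟨s(u, v), huv, rfl⟩
  · rintro h _ ⟨e, he, rfl⟩
    induction e with
    | _ u v => exact h u v he

lemma edgeIdeal_le_varIdeal {C : Finset V} (hC : ∀ u v, G.Adj u v → u ∈ C ∨ v ∈ C) :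
    edgeIdeal K G ≤ varIdeal K C := by
  rw [edgeIdeal_le]
  intro u v huv
  rcases hC u v huv with h | h
  · exact Ideal.mul_mem_right _ _ (X_mem_varIdeal h)
  · exact Ideal.mul_mem_left _ _ (X_mem_varIdeal h)

/-- A set meeting every pair `x i, y i`, and containing the pairs indexed by `T`. -/
lemma card_add_card_le_of_pairs {ι : Type*} [Fintype ι] {x y : ι → V}
    (hinj : Function.Injective (Sum.elim x y)) {B : Finset V} (hB : ∀ i, x i ∈ B ∨ y i ∈ B)
    {T : Finset ι} (hT : ∀ i ∈ T, x i ∈ B ∧ y i ∈ B) : Fintype.card ι + T.card ≤ B.card := by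
  classical
  have h1 : Fintype.card ι ≤ (Finset.univ.filter (fun i => x i ∈ B) ∪
      Finset.univ.filter (fun i => y i ∈ B)).card := by
    rw [← Finset.card_univ]
    exact Finset.card_le_card fun i _ => by simpa using hB i
  have h2 : T.card ≤ (Finset.univ.filter (fun i => x i ∈ B) ∩
      Finset.univ.filter (fun i => y i ∈ B)).card :=
    Finset.card_le_card fun i hi => by simpa using hT i hi
  have h3 : ((Finset.univ.filter (fun i => x i ∈ B)).disjSum
      (Finset.univ.filter (fun i => y i ∈ B))).card ≤ B.card := by
    refine Finset.card_le_card_of_injOn (Sum.elim x y) ?_ hinj.injOn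
    rintro (i | i) hi <;> simpa using hi
  rw [Finset.card_disjSum, ← Finset.card_union_add_card_inter] at h3
  omega

end EdgeIdeal

/-- The vertices of `G` are `x i, y i` for `i` in a partially ordered set, and the edges are
`x i, y j` with `i ≤ j`. -/
structure IsOrderedMatching {V ι : Type*} [PartialOrder ι] (G : SimpleGraph V) (x y : ι → V) :
    Prop where
  bijective : Function.Bijective (Sum.elim x y)
  adj_iff : ∀ i j, G.Adj (x i) (y j) ↔ i ≤ j
  not_adj_x : ∀ i j, ¬ G.Adj (x i) (x j)
  not_adj_y : ∀ i j, ¬ G.Adj (y i) (y j)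

section Structure

open MvPolynomial

variable {V K : Type u} [Field K] [Fintype V] {G : SimpleGraph V} {A : Type u} [CommRing A]
  [IsLocalRing A] [IsNoetherianRing A] {φ : MvPolynomial V K →+* A} {d : ℕ}

lemma exists_associatedPrime_of_notMem {A : Type*} [CommRing A] [IsNoetherianRing A] {I : Ideal A}
    {a : A} (ha : a ∉ I) : ∃ P ∈ associatedPrimes A (A ⧸ I), ∀ b, b * a ∈ I → b ∈ P := by
  obtain ⟨P, hP, hle⟩ := exists_le_isAssociatedPrime_of_isNoetherianRing A (Ideal.Quotient.mk I a)
    (by rwa [Ne, Ideal.Quotient.eq_zero_iff_mem])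
  refine ⟨P, hP, fun b hb => hle ?_⟩
  rw [Submodule.mem_colon_singleton, Submodule.mem_bot, Algebra.smul_def,
      Ideal.Quotient.algebraMap_eq, ← map_mul, Ideal.Quotient.eq_zero_iff_mem]
  exact hb

lemma exists_associatedPrime_of_ne_zero {A : Type*} [CommRing A] [IsNoetherianRing A]
    {a : A} (ha : a ≠ 0) : ∃ P ∈ associatedPrimes A A, ∀ b, b * a = 0 → b ∈ P := by
  obtain ⟨P, hP, hle⟩ := exists_le_isAssociatedPrime_of_isNoetherianRing A a ha
  exact ⟨P, hP, fun b hb => hle (Submodule.mem_colon_singleton.2 hb)⟩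

lemma IsLocQuot.apply_ne_zero {S A : Type*} [CommRing S] [CommRing A] {J q P : Ideal S}
    {φ : S →+* A} (h : IsLocQuot J q φ) [hP : P.IsPrime] (hJ : J ≤ P) (hq : P ≤ q) {f : S}
    (hf : f ∉ P) : φ f ≠ 0 := by
  intro h0
  obtain ⟨t, ht, htf⟩ := h.exists_mul_mem f h0
  exact (hP.mem_or_mem (hJ htf)).elim (fun h' => ht (hq h')) hf

/-- In the Cohen-Macaulay case, every minimal vertex cover has minimal cardinality. -/
lemma card_le_card_of_minimal_cover
    (h : IsLocQuot (edgeIdeal K G) (RingHom.ker constantCoeff) φ)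
    (hd : ringKrullDim A = d) (hD : DepthGE A A d) {C C' : Finset V}
    (hC : ∀ u v, G.Adj u v → u ∈ C ∨ v ∈ C) (hC' : ∀ u v, G.Adj u v → u ∈ C' ∨ v ∈ C')
    (hmin : ∀ u ∈ C, ∃ v, v ∉ C ∧ G.Adj u v) : C.card ≤ C'.card := by
  classical
  have hX : ∀ v, X v ∈ RingHom.ker (constantCoeff : MvPolynomial V K →+* K) := by simp
  have := isPrime_varIdeal (K := K) C
  have hf : (∏ v ∈ Cᶜ, X v : MvPolynomial V K) ∉ varIdeal K C := by
    rw [Ideal.IsPrime.prod_mem_iff]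
    rintro ⟨v, hv, hvC⟩
    rw [X_mem_varIdeal_iff] at hvC
    exact Finset.mem_compl.1 hv hvC
  obtain ⟨P, hP, hb⟩ := exists_associatedPrime_of_ne_zero
    (h.apply_ne_zero (edgeIdeal_le_varIdeal hC) (varIdeal_le.2 fun v _ => hX v) hf)
  refine h.card_le_card_add hX (k := 0) hd.le hD (edgeIdeal_le_varIdeal hC') hP fun u hu => hb _ ?_
  obtain ⟨v, hv, huv⟩ := hmin u hu
  rw [← map_mul]
  refine h.apply_eq_zero _ ?_
  rw [← Finset.mul_prod_erase _ _ (Finset.mem_compl.2 hv), ← mul_assoc]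
  exact Ideal.mul_mem_right _ _ (X_mul_X_mem_edgeIdeal huv)

end Structure

section Matching

open MvPolynomial

/-- A bipartite graph in which both sides are minimum vertex covers has a perfect matching. -/
lemma exists_perfect_matching {V : Type*} [Fintype V] {G : SimpleGraph V} {a : Set V}
    (ha : ∀ ⦃u v⦄, G.Adj u v → (u ∈ a ↔ v ∉ a))
    (hmin : ∀ C C' : Finset V, ((∀ v, v ∈ C ↔ v ∈ a) ∨ (∀ v, v ∈ C ↔ v ∉ a)) →
      (∀ u v, G.Adj u v → u ∈ C' ∨ v ∈ C') → C.card ≤ C'.card) :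
    ∃ y : a → V, Function.Bijective (Sum.elim (Subtype.val : a → V) y) ∧
      (∀ i : a, G.Adj i (y i)) ∧ ∀ i, y i ∉ a := by
  classical
  set Cx : Finset V := Finset.univ.filter (· ∈ a) with hCx
  set Cy : Finset V := Finset.univ.filter (· ∉ a) with hCy
  have hx : ∀ v, v ∈ Cx ↔ v ∈ a := by simp [hCx]
  have hy : ∀ v, v ∈ Cy ↔ v ∉ a := by simp [hCy]
  have hcx : ∀ u v, G.Adj u v → u ∈ Cx ∨ v ∈ Cx := by
    intro u v huv
    rw [hx, hx, ha huv]
    tauto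
  have hcy : ∀ u v, G.Adj u v → u ∈ Cy ∨ v ∈ Cy := by
    intro u v huv
    rw [hy, hy, ha huv]
    tauto
  have hcard : Cx.card = Cy.card := le_antisymm (hmin Cx Cy (.inl hx) hcy) (hmin Cy Cx (.inr hy) hcx)
  obtain ⟨y, hyinj, hyN⟩ := (Finset.all_card_le_biUnion_card_iff_exists_injective
    (fun i : a => Finset.univ.filter (G.Adj i))).1 (by
      intro s
      let s' : Finset V := s.map ⟨Subtype.val, Subtype.val_injective⟩
      have hs' : s' ⊆ Cx := by
        intro v hv
        obtain ⟨i, -, rfl⟩ := Finset.mem_map.1 hv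
        exact (hx _).2 i.2
      have h1 := hmin Cx ((Cx \ s') ∪ s.biUnion fun i : a => Finset.univ.filter (G.Adj i))
        (.inl hx) (by
          have key : ∀ u v, G.Adj u v → u ∈ a →
              u ∈ (Cx \ s') ∪ s.biUnion (fun i : a => Finset.univ.filter (G.Adj i)) ∨
              v ∈ (Cx \ s') ∪ s.biUnion (fun i : a => Finset.univ.filter (G.Adj i)) := by
            intro u v huv hu
            by_cases hus : (⟨u, hu⟩ : a) ∈ s
            · right
              exact Finset.mem_union_right _ (Finset.mem_biUnion.2 ⟨_, hus, by simpa using huv⟩)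
            · left
              refine Finset.mem_union_left _ (Finset.mem_sdiff.2 ⟨(hx u).2 hu, fun h => hus ?_⟩)
              obtain ⟨i, hi, rfl⟩ := Finset.mem_map.1 h
              exact hi
          intro u v huv
          by_cases hu : u ∈ a
          · exact key u v huv hu
          · exact (key v u huv.symm (by by_contra hv; exact hu ((ha huv).2 hv))).symm)
      have h2 := h1.trans (Finset.card_union_le _ _)
      rw [Finset.card_sdiff_of_subset hs', Finset.card_map] at h2
      have h3 := Finset.card_le_card hs'
      rw [Finset.card_map] at h3
      omega)
  have hadj : ∀ i : a, G.Adj i (y i) := fun i => by simpa using hyN i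
  have hya : ∀ i, y i ∉ a := fun i => (ha (hadj i)).1 i.2
  refine ⟨y, ⟨Subtype.val_injective.sumElim hyinj fun i j h => hya j (h ▸ i.2), ?_⟩, hadj, hya⟩
  intro v
  by_cases hv : v ∈ a
  · exact ⟨.inl ⟨v, hv⟩, rfl⟩
  · have himg : Finset.univ.image y = Cy := by
      refine Finset.eq_of_subset_of_card_le ?_ ?_
      · intro w hw
        obtain ⟨i, -, rfl⟩ := Finset.mem_image.1 hw
        exact (hy _).2 (hya i)
      · rw [Finset.card_image_of_injective _ hyinj, ← hcard, Finset.card_univ, hCx,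
          Fintype.card_subtype]
    obtain ⟨i, -, hi⟩ := Finset.mem_image.1 (himg ▸ (hy v).2 hv)
    exact ⟨.inr i, hi⟩

lemma IsLocQuot.mem_or_mem_of_adj {V K A : Type*} [Field K] [CommRing A]
    {G : SimpleGraph V} {φ : MvPolynomial V K →+* A} {q : Ideal (MvPolynomial V K)}
    (h : IsLocQuot (edgeIdeal K G) q φ) {P : Ideal A}
    (hP : P.IsPrime) {u v : V} (huv : G.Adj u v) : φ (X u) ∈ P ∨ φ (X v) ∈ P := by
  apply hP.mem_or_mem
  rw [← map_mul, h.apply_eq_zero _ (X_mul_X_mem_edgeIdeal huv)]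
  exact zero_mem P

variable {V K : Type u} [Field K] [Fintype V] {G : SimpleGraph V} {A : Type u} [CommRing A]
  [IsLocalRing A] [IsNoetherianRing A] {φ : MvPolynomial V K →+* A} {d : ℕ}
  {ι : Type*} [Fintype ι] {x y : ι → V}

/-- An associated prime contains at most `k` pairs of matched variables. -/
lemma card_pairs_le (h : IsLocQuot (edgeIdeal K G) (RingHom.ker constantCoeff) φ) {k : ℕ}
    (hd : ringKrullDim A ≤ (d + k : ℕ)) {M : Type u} [AddCommGroup M] [Module A M]
    [Module.Finite A M] (hD : DepthGE A M d) (hbij : Function.Injective (Sum.elim x y))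
    (hadj : ∀ i, G.Adj (x i) (y i)) (hcov : ∀ u v, G.Adj u v → (∃ i, x i = u) ∨ ∃ i, x i = v)
    {P : Ideal A} (hP : P ∈ associatedPrimes A M) (T : Finset ι)
    (hT : ∀ i ∈ T, φ (X (x i)) ∈ P ∧ φ (X (y i)) ∈ P) : T.card ≤ k := by
  classical
  have h1 := card_add_card_le_of_pairs hbij (B := Finset.univ.filter fun v => φ (X v) ∈ P) (T := T)
    (fun i => by simpa using h.mem_or_mem_of_adj hP.1 (hadj i)) (by simpa using hT)
  have h2 := h.card_le_card_add (by simp) hd hD (C := Finset.univ.image x)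
    (edgeIdeal_le_varIdeal (by simpa using hcov)) hP
    (B := Finset.univ.filter fun v => φ (X v) ∈ P) (by simp)
  have h3 := Finset.card_image_le (s := Finset.univ) (f := x)
  rw [Finset.card_univ] at h3
  omega

lemma adj_trans (h : IsLocQuot (edgeIdeal K G) (RingHom.ker constantCoeff) φ)
    (hd : ringKrullDim A = d) (hD : DepthGE A A d) (hbij : Function.Injective (Sum.elim x y))
    (hadj : ∀ i, G.Adj (x i) (y i)) (hcov : ∀ u v, G.Adj u v → (∃ i, x i = u) ∨ ∃ i, x i = v)
    {i j k : ι} (hij : G.Adj (x i) (y j)) (hjk : G.Adj (x j) (y k)) : G.Adj (x i) (y k) := by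
  classical
  by_contra hik
  have hX : ∀ v, X v ∈ RingHom.ker (constantCoeff : MvPolynomial V K →+* K) := by simp
  have hprime := isPrime_varIdeal (K := K) (V := V) ({x i, y k} : Finset V)ᶜ
  have hf : (X (x i) * X (y k) : MvPolynomial V K) ∉ varIdeal K ({x i, y k} : Finset V)ᶜ := by
    rw [hprime.mul_mem_iff_mem_or_mem, X_mem_varIdeal_iff, X_mem_varIdeal_iff]
    simp
  have hI : edgeIdeal K G ≤ varIdeal K ({x i, y k} : Finset V)ᶜ := by
    refine edgeIdeal_le_varIdeal fun u v huv => ?_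
    by_contra! hcon
    simp only [Finset.mem_compl, Finset.mem_insert, Finset.mem_singleton, not_not] at hcon
    obtain ⟨rfl | rfl, rfl | rfl⟩ := hcon
    · exact G.irrefl huv
    · exact hik huv
    · exact hik huv.symm
    · exact G.irrefl huv
  obtain ⟨P, hP, hb⟩ := exists_associatedPrime_of_ne_zero
    (h.apply_ne_zero hI (varIdeal_le.2 fun v _ => hX v) hf)
  have := card_pairs_le h (k := 0) hd.le hD hbij hadj hcov hP {j} (by
    simp only [Finset.mem_singleton, forall_eq]
    refine ⟨hb _ ?_, hb _ ?_⟩ <;> rw [← map_mul] <;> refine h.apply_eq_zero _ ?_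
    · rw [mul_left_comm]
      exact Ideal.mul_mem_left _ _ (X_mul_X_mem_edgeIdeal hjk)
    · rw [← mul_assoc, mul_comm (X (y j))]
      exact Ideal.mul_mem_right _ _ (X_mul_X_mem_edgeIdeal hij))
  simp at this

lemma adj_antisymm (h : IsLocQuot (edgeIdeal K G) (RingHom.ker constantCoeff) φ)
    (hd : ringKrullDim A = d) (hD : DepthGE A A d) (hbij : Function.Injective (Sum.elim x y))
    (hadj : ∀ i, G.Adj (x i) (y i)) (hcov : ∀ u v, G.Adj u v → (∃ i, x i = u) ∨ ∃ i, x i = v)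
    (hxx : ∀ i j, ¬ G.Adj (x i) (x j)) (hyy : ∀ i j, ¬ G.Adj (y i) (y j))
    {i j : ι} (hij : G.Adj (x i) (y j)) (hji : G.Adj (x j) (y i)) : i = j := by
  classical
  by_contra hne
  have hX : ∀ v, X v ∈ RingHom.ker (constantCoeff : MvPolynomial V K →+* K) := by simp
  set f : MvPolynomial V K := X (x i) + X (y i) with hf
  have hreg : ∀ a : A, φ f * a = 0 → a = 0 := by
    intro a ha
    by_contra ha0
    obtain ⟨P, hP, hb⟩ := exists_associatedPrime_of_ne_zero ha0
    have hfP := hb _ ha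
    rw [hf, map_add] at hfP
    have hboth : φ (X (x i)) ∈ P ∧ φ (X (y i)) ∈ P := by
      rcases h.mem_or_mem_of_adj hP.1 (hadj i) with h' | h'
      · exact ⟨h', (P.add_mem_iff_right h').1 hfP⟩
      · exact ⟨(P.add_mem_iff_left h').1 hfP, h'⟩
    have := card_pairs_le h (k := 0) hd.le hD hbij hadj hcov hP {i} (by simpa using hboth)
    simp at this
  obtain ⟨e, rfl⟩ : ∃ e, d = e + 1 := by
    refine Nat.exists_eq_succ_of_ne_zero ?_
    rintro rfl
    have h1 := h.card_le_ringKrullDim_add hX (C := Finset.univ.image x)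
      (edgeIdeal_le_varIdeal (by simpa using hcov))
    rw [hd] at h1
    have h2 : Fintype.card V ≤ 0 + (Finset.univ.image x).card := by exact_mod_cast h1
    have h3 := Finset.card_image_le (s := Finset.univ) (f := x)
    have h4 := Fintype.card_le_of_injective _ hbij
    have h5 : 0 < Fintype.card ι := Fintype.card_pos_iff.2 ⟨i⟩
    rw [Finset.card_univ] at h3
    rw [Fintype.card_sum] at h4
    omega
  have hDM : DepthGE A (A ⧸ Ideal.span {φ f}) e := by
    refine DepthGE.of_exact_left (LinearMap.lsmul A A (φ f)) (Ideal.span {φ f}).mkQ (fun a => ?_) ?_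
      (Submodule.mkQ_surjective _) hD (hD.mono (by omega))
    · rw [Submodule.mkQ_apply, Submodule.Quotient.mk_eq_zero, Ideal.mem_span_singleton]
      simp [dvd_iff_exists_eq_mul_right, eq_comm]
    · rw [injective_iff_map_eq_zero]
      exact hreg
  have hnot : φ (X (x i)) ∉ Ideal.span {φ f} := by
    intro hmem
    have h1 : φ (X (x i)) ∈ (edgeIdeal K G ⊔ Ideal.span {f}).map φ := by
      rw [Ideal.map_sup, Ideal.map_span _ {f}, Set.image_singleton]
      exact Ideal.mem_sup_right hmem
    rw [h.apply_mem_map_iff le_sup_left] at h1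
    obtain ⟨t, ht, h2⟩ := h1
    let θ : MvPolynomial V K →ₐ[K] Polynomial K := aeval fun v =>
      if v = x i then Polynomial.X else if v = y i then -Polynomial.X else 0
    have hyx : ∀ a b, y a ≠ x b := fun a b hab => by simpa using hbij (a₁ := .inr a) (a₂ := .inl b) hab
    have hxx' : θ (X (x i)) = Polynomial.X := by simp [θ]
    have hyy' : θ (X (y i)) = -Polynomial.X := by simp [θ, hyx]
    have hle : edgeIdeal K G ⊔ Ideal.span {f} ≤ (Ideal.span {Polynomial.X ^ 2}).comap θ := by
      refine sup_le (edgeIdeal_le.2 fun u v huv => ?_) ?_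
      · rw [Ideal.mem_comap, map_mul]
        by_cases hu : u = x i ∨ u = y i
        · by_cases hv : v = x i ∨ v = y i
          · rcases hu with rfl | rfl <;> rcases hv with rfl | rfl
            · exact absurd huv (hxx _ _)
            · rw [hxx', hyy', Ideal.mem_span_singleton]
              exact ⟨-1, by ring⟩
            · rw [hxx', hyy', Ideal.mem_span_singleton]
              exact ⟨-1, by ring⟩
            · exact absurd huv (hyy _ _)
          · have : θ (X v) = 0 := by simp [θ, not_or.1 hv]
            rw [this, mul_zero]
            exact zero_mem _
        · have : θ (X u) = 0 := by simp [θ, not_or.1 hu]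
          rw [this, zero_mul]
          exact zero_mem _
      · rw [Ideal.span_singleton_le_iff_mem, Ideal.mem_comap, hf, map_add, hxx', hyy',
          add_neg_cancel]
        exact zero_mem _
    have h3 := hle h2
    rw [Ideal.mem_comap, map_mul, hxx', Ideal.mem_span_singleton, pow_two] at h3
    have h4 := (mul_dvd_mul_iff_right Polynomial.X_ne_zero).1 h3
    rw [Polynomial.X_dvd_iff] at h4
    refine ht ?_
    have hcc : (Polynomial.constantCoeff : Polynomial K →+* K).comp θ.toRingHom =
        constantCoeff := by
      ext v
      · simp
      · simp only [θ, RingHom.comp_apply, AlgHom.toRingHom_eq_coe, RingHom.coe_coe, aeval_X]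
        split_ifs <;> simp
    rw [RingHom.mem_ker, ← hcc]
    exact h4
  obtain ⟨P, hP, hb⟩ := exists_associatedPrime_of_notMem hnot
  have hfS : ∀ g r s : MvPolynomial V K, r ∈ edgeIdeal K G → g * X (x i) = r + s * f →
      φ g ∈ P := by
    intro g r s hr hg
    refine hb _ ?_
    rw [← map_mul, hg, map_add φ r, h.apply_eq_zero r hr, zero_add, map_mul φ s]
    exact Ideal.mul_mem_left _ _ (Ideal.mem_span_singleton_self _)
  have := card_pairs_le h (k := 1) (by exact_mod_cast hd.le) hDM hbij hadj hcov hP {i, j} (by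
    simp only [Finset.mem_insert, Finset.mem_singleton, forall_eq_or_imp, forall_eq]
    refine ⟨⟨?_, ?_⟩, ?_, ?_⟩
    · exact hfS _ (-(X (x i) * X (y i))) (X (x i)) (neg_mem (X_mul_X_mem_edgeIdeal (hadj i)))
        (by rw [hf]; ring)
    · exact hfS _ (X (x i) * X (y i)) 0 (X_mul_X_mem_edgeIdeal (hadj i)) (by ring)
    · exact hfS _ (-(X (x j) * X (y i))) (X (x j)) (neg_mem (X_mul_X_mem_edgeIdeal hji))
        (by rw [hf]; ring)
    · exact hfS _ (X (x i) * X (y j)) 0 (X_mul_X_mem_edgeIdeal hij) (by ring))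
  rw [Finset.card_pair hne] at this
  omega

/-- The structure of Cohen-Macaulay bipartite graphs. -/
theorem exists_isOrderedMatching {V K : Type u} [Field K] [Fintype V] {G : SimpleGraph V}
    (hbip : IsBipartite G) (hiso : HasNoIsolatedVertices G)
    (hCM : IsCohenMacaulayRing (MvPolynomial V K ⧸ edgeIdeal K G)) :
    ∃ (ι : Type u) (_ : Fintype ι) (_ : PartialOrder ι) (x y : ι → V),
      IsOrderedMatching G x y := by
  classical
  obtain ⟨a, ha⟩ := hbip
  obtain ⟨A, _, _, _, φ, h, d, hd, hD⟩ := hCM.exists_isLocQuot (isMaximal_ker_constantCoeff V K)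
    (edgeIdeal_le.2 fun u v _ => by simp)
  obtain ⟨y, hbij, hadj, hya⟩ := exists_perfect_matching ha (by
    intro C C' hC hC'
    refine card_le_card_of_minimal_cover h hd hD (fun u v huv => ?_) hC' fun u hu => ?_
    · have := ha huv
      rcases hC with hC | hC <;> rw [hC, hC] <;> tauto
    · obtain ⟨v, hv⟩ := hiso u
      have := ha hv
      refine ⟨v, ?_, hv⟩
      rcases hC with hC | hC <;> rw [hC] at hu ⊢ <;> tauto)
  have hcov : ∀ u v, G.Adj u v → (∃ i : a, (i : V) = u) ∨ ∃ i : a, (i : V) = v := by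
    intro u v huv
    have := ha huv
    simp only [Subtype.exists, exists_prop, exists_eq_right]
    tauto
  have hxx : ∀ i j : a, ¬ G.Adj (i : V) j := fun i j hij => (ha hij).1 i.2 j.2
  have hyy : ∀ i j : a, ¬ G.Adj (y i) (y j) := fun i j hij => hya i ((ha hij).2 (hya j))
  let P : PartialOrder a :=
    { le := fun i j => G.Adj i (y j)
      le_refl := hadj
      le_trans := fun i j k => adj_trans h hd hD hbij.1 hadj hcov
      le_antisymm := fun i j => adj_antisymm h hd hD hbij.1 hadj hcov hxx hyy }
  exact ⟨a, inferInstance, P, Subtype.val, y, hbij, fun _ _ => Iff.rfl, hxx, hyy⟩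

end Matching

section MonomialIdeal

open MvPolynomial

variable {V K : Type*} [Field K]

/-- The ideal spanned by the monomials with exponents in `Φ`. -/
noncomputable def monIdeal (K : Type*) [Field K] (Φ : Set (V →₀ ℕ)) : Ideal (MvPolynomial V K) :=
  Ideal.span ((fun s => monomial s 1) '' Φ)

lemma mem_monIdeal {Φ : Set (V →₀ ℕ)} (hΦ : IsUpperSet Φ) {f : MvPolynomial V K} :
    f ∈ monIdeal K Φ ↔ ∀ m ∈ f.support, m ∈ Φ := by
  rw [monIdeal, mem_ideal_span_monomial_image]
  exact ⟨fun h m hm => (h m hm).elim fun i hi => hΦ hi.2 hi.1, fun h m hm => ⟨m, h m hm, le_rfl⟩⟩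

lemma monomial_mem_monIdeal {Φ : Set (V →₀ ℕ)} (hΦ : IsUpperSet Φ) {m : V →₀ ℕ} :
    monomial m (1 : K) ∈ monIdeal K Φ ↔ m ∈ Φ := by
  classical
  rw [mem_monIdeal hΦ, support_monomial, if_neg one_ne_zero]
  simp

lemma monIdeal_le {Φ : Set (V →₀ ℕ)} {I : Ideal (MvPolynomial V K)} :
    monIdeal K Φ ≤ I ↔ ∀ m ∈ Φ, monomial m (1 : K) ∈ I := by
  rw [monIdeal, Ideal.span_le]
  exact ⟨fun h m hm => h ⟨m, hm, rfl⟩, by rintro h _ ⟨m, hm, rfl⟩; exact h m hm⟩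

end MonomialIdeal

section EdgeExponents

variable {ι : Type*} [PartialOrder ι]

/-- The exponent with values `α i` at `x i` and `β i` at `y i` lies in the weighted edge ideal of
the ordered matching. -/
def EdgeExp (W : ι → ι → ℕ) (α β : ι → ℕ) : Prop :=
  ∃ i k, i ≤ k ∧ W i k ≤ α i ∧ W i k ≤ β k

/-- No socle element is killed by both variables of a matched pair. -/
def PairRegular [DecidableEq ι] (W : ι → ι → ℕ) : Prop :=
  ∀ (α β : ι → ℕ) (j : ι), EdgeExp W (Function.update α j (α j + 1)) β →
    EdgeExp W α (Function.update β j (β j + 1)) → EdgeExp W α β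

lemma EdgeExp.mono {W : ι → ι → ℕ} {α β α' β' : ι → ℕ} (h : EdgeExp W α β) (hα : α ≤ α')
    (hβ : β ≤ β') : EdgeExp W α' β' := by
  obtain ⟨i, k, hik, h1, h2⟩ := h
  exact ⟨i, k, hik, h1.trans (hα i), h2.trans (hβ k)⟩

variable [DecidableEq ι]

lemma PairRegular.dual {W : ι → ι → ℕ} (h : PairRegular W) :
    PairRegular (ι := ιᵒᵈ) (fun i j => W (OrderDual.ofDual j) (OrderDual.ofDual i)) := by
  have key : ∀ α β : ι → ℕ,
      EdgeExp (ι := ιᵒᵈ) (fun i j => W (OrderDual.ofDual j) (OrderDual.ofDual i)) α β ↔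
        EdgeExp W β α := fun α β =>
    ⟨fun ⟨i, k, hik, h1, h2⟩ => ⟨k, i, hik, h2, h1⟩, fun ⟨i, k, hik, h1, h2⟩ => ⟨k, i, hik, h2, h1⟩⟩
  intro α β j h1 h2
  exact (key α β).2 (h β α j ((key _ _).1 h2) ((key _ _).1 h1))

lemma PairRegular.le_diag {W : ι → ι → ℕ} (h : PairRegular W) (hW : ∀ i j, i ≤ j → 0 < W i j)
    {i k : ι} (hik : i ≤ k) : W i k ≤ W i i := by
  by_contra! hlt
  have hne : k ≠ i := by rintro rfl; exact hlt.false
  have h0 := hW i i le_rfl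
  obtain ⟨s, t, hst, h1, h2⟩ := h (fun s => if s = i then W i k - 1 else 0)
    (fun s => if s = i then W i i - 1 else if s = k then W i k else 0) i
    ⟨i, k, hik, by simp; omega, by simp [hne]⟩ ⟨i, i, le_rfl, by simp; omega, by simp; omega⟩
  have hst0 := hW s t hst
  dsimp only at h1 h2
  split_ifs at h1 h2 <;> subst_vars <;> omega

lemma PairRegular.le_left {W : ι → ι → ℕ} (h : PairRegular W) (hW : ∀ i j, i ≤ j → 0 < W i j)
    {i j k : ι} (hij : i ≤ j) (hjk : j ≤ k) : W i k ≤ W i j := by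
  by_contra! hlt
  rcases hij.eq_or_lt with rfl | hij
  · exact (h.le_diag hW hjk).not_gt hlt
  rcases hjk.eq_or_lt with rfl | hjk
  · exact hlt.false
  have h0 := hW i j hij.le
  have h0' := hW j k hjk.le
  have h0'' := h.le_diag hW hjk.le
  have e1 := hij.ne'
  have e2 := hjk.ne'
  have e3 := (hij.trans hjk).ne'
  obtain ⟨s, t, hst, h1, h2⟩ := h (fun s => if s = i then W i k - 1 else if s = j then W j k - 1 else 0)
    (fun s => if s = j then W i j - 1 else if s = k then max (W i k) (W j k) else 0) j
    ⟨j, k, hjk.le, by simp [e1]; omega, by simp [e2]⟩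
    ⟨i, j, hij.le, by simp; omega, by simp; omega⟩
  have hst0 := hW s t hst
  dsimp only at h1 h2
  split_ifs at h1 h2 <;> subst_vars <;> omega

lemma PairRegular.le_right {W : ι → ι → ℕ} (h : PairRegular W) (hW : ∀ i j, i ≤ j → 0 < W i j)
    {i j k : ι} (hij : i ≤ j) (hjk : j ≤ k) : W i k ≤ W j k :=
  h.dual.le_left (fun _ _ hij => hW _ _ hij) (i := OrderDual.toDual k) (j := OrderDual.toDual j)
    (k := OrderDual.toDual i) hjk hij

end EdgeExponents

section Unmixed

open MvPolynomial

variable {V K : Type*} [Field K] {ι : Type*} [PartialOrder ι] {G : SimpleGraph V} {x y : ι → V}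

/-- The exponents of the monomials in the weighted edge ideal of an ordered matching. -/
def edgeExponents (x y : ι → V) (W : ι → ι → ℕ) : Set (V →₀ ℕ) :=
  {m | EdgeExp W (fun i => m (x i)) (fun i => m (y i))}

lemma isUpperSet_edgeExponents (W : ι → ι → ℕ) : IsUpperSet (edgeExponents x y W) :=
  fun _ _ hab ha => EdgeExp.mono ha (fun i => hab (x i)) (fun i => hab (y i))

lemma edgeMonomial_mk (w : Sym2 V → ℕ) (u v : V) : edgeMonomial K w s(u, v) =
    monomial (Finsupp.single u (w s(u, v)) + Finsupp.single v (w s(u, v))) 1 := by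
  rw [edgeMonomial, Sym2.lift_mk, mul_pow, X_pow_eq_monomial, X_pow_eq_monomial, monomial_mul,
    one_mul]

/-- A prime containing a weighted edge ideal contains a variable of each edge. -/
lemma X_mem_or_X_mem_of_le {W : ι → ι → ℕ} {P : Ideal (MvPolynomial V K)} (hP : P.IsPrime)
    (hJ : monIdeal K (edgeExponents x y W) ≤ P) {i j : ι} (hij : i ≤ j) :
    X (x i) ∈ P ∨ X (y j) ∈ P := by
  have h1 : (X (x i) ^ W i j * X (y j) ^ W i j : MvPolynomial V K) ∈ P := by
    apply hJ
    rw [X_pow_eq_monomial, X_pow_eq_monomial, monomial_mul, one_mul,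
      monomial_mem_monIdeal (isUpperSet_edgeExponents _)]
    exact ⟨i, j, hij, by simp, by simp⟩
  exact (hP.mem_or_mem h1).imp (hP.mem_of_pow_mem _) (hP.mem_of_pow_mem _)

lemma monIdeal_le_varIdeal {W : ι → ι → ℕ} (hW : ∀ i j, i ≤ j → 0 < W i j) {C : Finset V}
    (hC : ∀ i j, i ≤ j → x i ∈ C ∨ y j ∈ C) :
    monIdeal K (edgeExponents x y W) ≤ varIdeal K C := by
  rw [monIdeal_le]
  rintro m ⟨i, j, hij, h1, h2⟩
  have h0 := hW i j hij
  rw [varIdeal, mem_ideal_span_X_image]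
  intro m' hm'
  have := Finset.mem_singleton.1 (support_monomial_subset hm')
  subst this
  dsimp only at h1 h2
  rcases hC i j hij with h | h
  · exact ⟨_, h, by omega⟩
  · exact ⟨_, h, by omega⟩

namespace IsOrderedMatching

variable (hG : IsOrderedMatching G x y)

include hG

lemma x_injective : Function.Injective x := fun i j h => by
  simpa using hG.bijective.1 (a₁ := .inl i) (a₂ := .inl j) h

lemma y_injective : Function.Injective y := fun i j h => by
  simpa using hG.bijective.1 (a₁ := .inr i) (a₂ := .inr j) h

lemma x_ne_y (i j : ι) : x i ≠ y j := fun h => by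
  simpa using hG.bijective.1 (a₁ := .inl i) (a₂ := .inr j) h

lemma eq_x_or_eq_y (v : V) : (∃ i, x i = v) ∨ ∃ i, y i = v := by
  obtain ⟨i | i, hi⟩ := hG.bijective.2 v
  · exact .inl ⟨i, hi⟩
  · exact .inr ⟨i, hi⟩

lemma adj_cases {u v : V} (huv : G.Adj u v) :
    ∃ i j, i ≤ j ∧ (u = x i ∧ v = y j ∨ u = y j ∧ v = x i) := by
  obtain ⟨i, rfl⟩ | ⟨i, rfl⟩ := hG.eq_x_or_eq_y u <;> obtain ⟨j, rfl⟩ | ⟨j, rfl⟩ := hG.eq_x_or_eq_y v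
  · exact absurd huv (hG.not_adj_x i j)
  · exact ⟨i, j, (hG.adj_iff i j).1 huv, .inl ⟨rfl, rfl⟩⟩
  · exact ⟨j, i, (hG.adj_iff j i).1 huv.symm, .inr ⟨rfl, rfl⟩⟩
  · exact absurd huv (hG.not_adj_y i j)

lemma card_eq [Fintype V] [Fintype ι] : Fintype.card V = Fintype.card ι + Fintype.card ι := by
  rw [← Fintype.card_sum]
  exact (Fintype.card_of_bijective hG.bijective).symm

lemma weightedEdgeIdeal_eq (w : Sym2 V → ℕ) : weightedEdgeIdeal K G w =
    monIdeal K (edgeExponents x y fun i j => w s(x i, y j)) := by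
  apply le_antisymm
  · rw [weightedEdgeIdeal, Ideal.span_le]
    rintro _ ⟨e, he, rfl⟩
    have key : ∀ i j, i ≤ j → edgeMonomial K w s(x i, y j) ∈
        monIdeal K (edgeExponents x y fun i j => w s(x i, y j)) := by
      intro i j hij
      rw [edgeMonomial_mk, monomial_mem_monIdeal (isUpperSet_edgeExponents _)]
      exact ⟨i, j, hij, by simp, by simp⟩
    induction e with
    | _ u v =>
      obtain ⟨i, j, hij, ⟨rfl, rfl⟩ | ⟨rfl, rfl⟩⟩ := hG.adj_cases he
      · exact key i j hij
      · rw [Sym2.eq_swap]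
        exact key i j hij
  · rw [monIdeal_le]
    rintro m ⟨i, j, hij, h1, h2⟩
    have hle : Finsupp.single (x i) (w s(x i, y j)) + Finsupp.single (y j) (w s(x i, y j)) ≤ m := by
      classical
      intro v
      have := hG.x_ne_y i j
      simp only [Finsupp.add_apply, Finsupp.single_apply]
      split_ifs with h3 h4 h4
      · exact absurd (h3.trans h4.symm) this
      · subst h3; simpa using h1
      · subst h4; simpa using h2
      · simp
    rw [← tsub_add_cancel_of_le hle, ← one_mul (1 : K), ← monomial_mul, ← edgeMonomial_mk]
    exact Ideal.mul_mem_left _ _ (Ideal.subset_span ⟨_, (hG.adj_iff i j).2 hij, rfl⟩)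

lemma exists_exponent [Finite V] (α β : ι → ℕ) :
    ∃ m : V →₀ ℕ, (fun i => m (x i)) = α ∧ (fun i => m (y i)) = β := by
  let e := Equiv.ofBijective _ hG.bijective
  refine ⟨Finsupp.equivFunOnFinite.symm fun v => Sum.elim α β (e.symm v), ?_, ?_⟩ <;> ext i
  · have : e.symm (x i) = .inl i := e.symm_apply_eq.2 rfl
    simp [this]
  · have : e.symm (y i) = .inr i := e.symm_apply_eq.2 rfl
    simp [this]

lemma varIdeal_mem_associatedPrimes [Fintype V] [Fintype ι] [DecidableEq V] {W : ι → ι → ℕ}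
    (hW : ∀ i j, i ≤ j → 0 < W i j) : varIdeal K (Finset.univ.image x) ∈
      associatedPrimes (MvPolynomial V K)
        (MvPolynomial V K ⧸ monIdeal K (edgeExponents x y W)) := by
  apply Module.associatedPrimes.minimalPrimes_annihilator_subset_associatedPrimes
  rw [Ideal.annihilator_quotient]
  refine ⟨⟨isPrime_varIdeal _, monIdeal_le_varIdeal hW (by simp)⟩, ?_⟩
  rintro Q ⟨hQ, hJ⟩ hle
  rw [varIdeal_le]
  intro v hv
  obtain ⟨i, -, rfl⟩ := Finset.mem_image.1 hv
  refine (X_mem_or_X_mem_of_le hQ hJ le_rfl).resolve_right fun h => ?_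
  have h1 := hle h
  rw [X_mem_varIdeal_iff] at h1
  obtain ⟨j, -, hj⟩ := Finset.mem_image.1 h1
  exact hG.x_ne_y _ _ hj

theorem pairRegular_of_isUnmixed [Fintype V] [Fintype ι] [DecidableEq ι] {W : ι → ι → ℕ}
    (hW : ∀ i j, i ≤ j → 0 < W i j)
    (hJ : IsUnmixedIdeal (monIdeal K (edgeExponents x y W))) : PairRegular W := by
  classical
  intro α β j h1 h2
  by_contra hcon
  obtain ⟨m, rfl, rfl⟩ := hG.exists_exponent α β
  have hm : (monomial m 1 : MvPolynomial V K) ∉ monIdeal K (edgeExponents x y W) := by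
    rwa [monomial_mem_monIdeal (isUpperSet_edgeExponents _)]
  obtain ⟨P, hP, hb⟩ := exists_associatedPrime_of_notMem hm
  have hJP : monIdeal K (edgeExponents x y W) ≤ P := fun f hf => hb f (Ideal.mul_mem_right _ _ hf)
  have hX : ∀ v, Finsupp.single v 1 + m ∈ edgeExponents x y W → X v ∈ P := by
    intro v hv
    apply hb
    rwa [X, monomial_mul, one_mul, monomial_mem_monIdeal (isUpperSet_edgeExponents _)]
  have h3 := card_add_card_le_of_pairs hG.bijective.1
    (B := Finset.univ.filter fun v => X v ∈ P) (T := {j})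
    (fun i => by simpa using X_mem_or_X_mem_of_le hP.1 hJP le_rfl)
    (by
      simp only [Finset.mem_singleton, forall_eq, Finset.mem_filter, Finset.mem_univ, true_and]
      refine ⟨hX _ (EdgeExp.mono h1 ?_ ?_), hX _ (EdgeExp.mono h2 ?_ ?_)⟩ <;> intro i
      · by_cases hij : i = j
        · subst hij; simp [add_comm]
        · simp [hij]
      · simp
      · simp
      · by_cases hij : i = j
        · subst hij; simp [add_comm]
        · simp [hij])
  have h4 := hJ _ (hG.varIdeal_mem_associatedPrimes hW) P hP
  have e1 := idealHeight_eq (varPrime K (Finset.univ.image x))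
  have e2 := idealHeight_eq ⟨P, hP.1⟩
  rw [height_varPrime] at e1
  have h5 : varPrime K (Finset.univ.filter fun v => X v ∈ P) ≤ ⟨P, hP.1⟩ :=
    varIdeal_le.2 (by simp)
  have h6 := Order.height_mono h5
  rw [height_varPrime] at h6
  have h7 : ((Finset.univ.image x).card : WithBot ℕ∞) = Order.height (⟨P, hP.1⟩ : PrimeSpectrum _) :=
    e1.symm.trans (h4.trans e2)
  have h8 : ((Finset.univ.image x).card : ℕ∞) = Order.height (⟨P, hP.1⟩ : PrimeSpectrum _) := by
    exact_mod_cast h7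
  rw [← h8] at h6
  have h9 : (Finset.univ.filter fun v => X v ∈ P).card ≤ (Finset.univ.image x).card := by
    exact_mod_cast h6
  have h10 := Finset.card_image_le (s := Finset.univ) (f := x)
  rw [Finset.card_univ] at h10
  rw [Finset.card_singleton] at h3
  omega

end IsOrderedMatching

end Unmixed

section DepthQuotient

open IsLocalRing

variable {A : Type u} [CommRing A] [IsLocalRing A]

/-- Depth of `A ⧸ I` from the exact sequence `0 → A ⧸ (I : a) → A ⧸ I → A ⧸ (I + (a)) → 0`. -/
lemma DepthGE.of_colon {I I' : Ideal A} {a : A} {n : ℕ} (hI' : ∀ b, b ∈ I' ↔ b * a ∈ I)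
    (h : DepthGE A (A ⧸ (I ⊔ Ideal.span {a})) n) (h' : DepthGE A (A ⧸ I') n) :
    DepthGE A (A ⧸ I) n := by
  have hle : I' ≤ Submodule.comap (LinearMap.mulRight A a) I := fun b hb => (hI' b).1 hb
  refine DepthGE.of_exact (Submodule.mapQ I' I (LinearMap.mulRight A a) hle)
    (Submodule.factor (le_sup_left : I ≤ I ⊔ Ideal.span {a})) ?_ ?_
    (Submodule.factor_surjective _) h' h
  · intro x
    obtain ⟨x, rfl⟩ := Submodule.Quotient.mk_surjective _ x
    change (Submodule.Quotient.mk x : A ⧸ (I ⊔ Ideal.span {a})) = 0 ↔ _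
    rw [Submodule.Quotient.mk_eq_zero]
    constructor
    · intro hx
      obtain ⟨i, hi, c, hc, rfl⟩ := Submodule.mem_sup.1 hx
      obtain ⟨b, rfl⟩ := Ideal.mem_span_singleton'.1 hc
      refine ⟨Submodule.Quotient.mk b, ?_⟩
      rw [Submodule.mapQ_apply, Submodule.Quotient.eq]
      simpa using hi
    · rintro ⟨b, hb⟩
      obtain ⟨b, rfl⟩ := Submodule.Quotient.mk_surjective _ b
      rw [Submodule.mapQ_apply, Submodule.Quotient.eq] at hb
      have h1 : b * a ∈ I ⊔ Ideal.span {a} :=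
        Ideal.mem_sup_right (Ideal.mul_mem_left _ _ (Ideal.mem_span_singleton_self a))
      simpa using sub_mem h1 (Ideal.mem_sup_left (T := Ideal.span {a}) hb)
  · rw [injective_iff_map_eq_zero]
    intro b hb
    obtain ⟨b, rfl⟩ := Submodule.Quotient.mk_surjective _ b
    rw [Submodule.mapQ_apply, Submodule.Quotient.mk_eq_zero] at hb
    rw [Submodule.Quotient.mk_eq_zero, hI']
    exact hb

lemma DepthGE.succ_quotient {I : Ideal A} {a : A} {n : ℕ} (ha : a ∈ maximalIdeal A)
    (hI : ∀ b, b * a ∈ I → b ∈ I) (h : DepthGE A (A ⧸ (I ⊔ Ideal.span {a})) n) :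
    DepthGE A (A ⧸ I) (n + 1) := by
  refine DepthGE.succ_of_regular ha
    (Submodule.factor (le_sup_left : I ≤ I ⊔ Ideal.span {a})) ?_ ?_
    (Submodule.factor_surjective _) h
  · intro x
    obtain ⟨x, rfl⟩ := Submodule.Quotient.mk_surjective _ x
    change (Submodule.Quotient.mk x : A ⧸ (I ⊔ Ideal.span {a})) = 0 ↔ _
    rw [Submodule.Quotient.mk_eq_zero]
    constructor
    · intro hx
      obtain ⟨i, hi, c, hc, rfl⟩ := Submodule.mem_sup.1 hx
      obtain ⟨b, rfl⟩ := Ideal.mem_span_singleton'.1 hc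
      refine ⟨Submodule.Quotient.mk b, ?_⟩
      rw [LinearMap.lsmul_apply, ← Submodule.Quotient.mk_smul, Submodule.Quotient.eq]
      simpa [mul_comm] using hi
    · rintro ⟨b, hb⟩
      obtain ⟨b, rfl⟩ := Submodule.Quotient.mk_surjective _ b
      rw [LinearMap.lsmul_apply, ← Submodule.Quotient.mk_smul, Submodule.Quotient.eq] at hb
      have h1 : a • b ∈ I ⊔ Ideal.span {a} :=
        Ideal.mem_sup_right (Ideal.mul_mem_right _ _ (Ideal.mem_span_singleton_self a))
      simpa using sub_mem h1 (Ideal.mem_sup_left (T := Ideal.span {a}) hb)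
  · rw [injective_iff_map_eq_zero]
    intro b hb
    obtain ⟨b, rfl⟩ := Submodule.Quotient.mk_surjective _ b
    rw [LinearMap.lsmul_apply, ← Submodule.Quotient.mk_smul, Submodule.Quotient.mk_eq_zero] at hb
    rw [Submodule.Quotient.mk_eq_zero]
    exact hI b (by rwa [mul_comm])

lemma IsLocQuot.mem_map_colon {S A : Type*} [CommRing S] [CommRing A] {J q : Ideal S}
    {φ : S →+* A} (h : IsLocQuot J q φ) {J₁ J₂ : Ideal S} {z : S} (hJ : J ≤ J₁) (hJ₂ : ∀ s, s ∈ J₂ ↔ s * z ∈ J₁)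
    (b : A) : b ∈ J₂.map φ ↔ b * φ z ∈ J₁.map φ := by
  have hle : J₁ ≤ J₂ := fun s hs => (hJ₂ s).2 (Ideal.mul_mem_right _ _ hs)
  obtain ⟨s, t, ht, e⟩ := h.surj b
  have hu := (h.isUnit_iff t).2 ht
  rw [← Ideal.mul_unit_mem_iff_mem _ hu, e, ← Ideal.mul_unit_mem_iff_mem (J₁.map φ) hu,
    mul_right_comm, e, ← map_mul, h.apply_mem_map_iff hJ, h.apply_mem_map_iff (hJ.trans hle)]
  simp only [hJ₂, mul_assoc]

variable {S : Type*} [CommRing S] {J q : Ideal S} {φ : S →+* A}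

namespace IsLocQuot

variable (h : IsLocQuot J q φ)

include h

lemma depthGE_of_colon {J₁ J₂ : Ideal S} {z : S} {n : ℕ} (hJ : J ≤ J₁)
    (hJ₂ : ∀ s, s ∈ J₂ ↔ s * z ∈ J₁)
    (h₁ : DepthGE A (A ⧸ (J₁ ⊔ Ideal.span {z}).map φ) n) (h₂ : DepthGE A (A ⧸ J₂.map φ) n) :
    DepthGE A (A ⧸ J₁.map φ) n := by
  rw [Ideal.map_sup, Ideal.map_span, Set.image_singleton] at h₁
  exact DepthGE.of_colon (h.mem_map_colon hJ hJ₂) h₁ h₂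

lemma depthGE_succ {J₁ : Ideal S} {z : S} {n : ℕ} (hJ : J ≤ J₁) (hz : z ∈ q)
    (hreg : ∀ s, s * z ∈ J₁ → s ∈ J₁) (h₁ : DepthGE A (A ⧸ (J₁ ⊔ Ideal.span {z}).map φ) n) :
    DepthGE A (A ⧸ J₁.map φ) (n + 1) := by
  rw [Ideal.map_sup, Ideal.map_span, Set.image_singleton] at h₁
  refine DepthGE.succ_quotient ?_ (fun b hb => (h.mem_map_colon hJ
    (fun s => ⟨fun hs => Ideal.mul_mem_right _ _ hs, hreg s⟩) b).2 hb) h₁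
  rw [mem_maximalIdeal, mem_nonunits_iff, h.isUnit_iff]
  exact not_not.2 hz

end IsLocQuot

end DepthQuotient

section CompleteIntersection

open MvPolynomial

variable {V K : Type*} [Field K]

/-- The ideal generated by the univariate polynomials `g v` in the variables `X v`, `v ∈ B`. -/
noncomputable def univIdeal (B : Finset V) (g : V → Polynomial K) : Ideal (MvPolynomial V K) :=
  Ideal.span ((fun v => Polynomial.aeval (X v) (g v)) '' (B : Set V))

lemma mem_univIdeal_of_mul_mem {B : Finset V} {g : V → Polynomial K} {v : V} (hv : v ∉ B)
    {p : Polynomial K} (hp : p.Monic) {s : MvPolynomial V K}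
    (hs : s * Polynomial.aeval (X v) p ∈ univIdeal B g) : s ∈ univIdeal B g := by
  classical
  let Q := MvPolynomial V K ⧸ univIdeal B g
  let θ : MvPolynomial V K →ₐ[K] Polynomial Q := aeval fun u =>
    if u = v then Polynomial.X else Polynomial.C (Ideal.Quotient.mk (univIdeal B g) (X u))
  have hθ : univIdeal B g ≤ RingHom.ker θ := by
    refine Ideal.span_le.2 ?_
    rintro _ ⟨u, hu, rfl⟩
    have huv : u ≠ v := by rintro rfl; exact hv hu
    have h1 : θ (X u) = Polynomial.CAlgHom (R := K) (Ideal.Quotient.mk (univIdeal B g) (X u)) := by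
      simp [θ, huv]
    have h2 : (Ideal.Quotient.mkₐ K (univIdeal B g)) (Polynomial.aeval (X u) (g u)) = 0 :=
      Ideal.Quotient.eq_zero_iff_mem.2 (Ideal.subset_span ⟨u, hu, rfl⟩)
    rw [← Polynomial.aeval_algHom_apply, Ideal.Quotient.mkₐ_eq_mk] at h2
    simp only [SetLike.mem_coe, RingHom.mem_ker]
    rw [← Polynomial.aeval_algHom_apply, h1, Polynomial.aeval_algHom_apply, h2, map_zero]
  have h3 : θ s = 0 := by
    have h4 : θ s * θ (Polynomial.aeval (X v) p) = 0 := by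
      rw [← map_mul]
      exact hθ hs
    have h5 : θ (Polynomial.aeval (X v) p) = p.map (algebraMap K Q) := by
      rw [← Polynomial.aeval_algHom_apply]
      simp [θ, Q, Polynomial.aeval_X_left_eq_map]
    rw [h5] at h4
    exact ((hp.map _).mul_left_eq_zero_iff).1 h4
  have h6 : ((Polynomial.aeval (Ideal.Quotient.mk (univIdeal B g) (X v))).restrictScalars K).comp θ =
      Ideal.Quotient.mkₐ K (univIdeal B g) := by
    ext u
    by_cases huv : u = v
    · subst huv; simp [θ]
    · simp [θ, huv]
  have h7 := DFunLike.congr_fun h6 s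
  rw [AlgHom.comp_apply, h3, map_zero] at h7
  exact Ideal.Quotient.eq_zero_iff_mem.1 h7.symm

/-- Every variable satisfies a monic equation modulo a maximal ideal. -/
lemma exists_monic_aeval_mem [Finite V] {q : Ideal (MvPolynomial V K)} (hq : q.IsMaximal) (v : V) :
    ∃ p : Polynomial K, p.Monic ∧ Polynomial.aeval (X v) p ∈ q := by
  let := Ideal.Quotient.field q
  have hfin : Module.Finite K (MvPolynomial V K ⧸ q) :=
    finite_of_finite_type_of_isJacobsonRing K (MvPolynomial V K ⧸ q)
  obtain ⟨p, hp, h0⟩ := Algebra.IsIntegral.isIntegral (R := K) (Ideal.Quotient.mkₐ K q (X v))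
  refine ⟨p, hp, ?_⟩
  rw [← Polynomial.aeval_def, Polynomial.aeval_algHom_apply] at h0
  exact Ideal.Quotient.eq_zero_iff_mem.1 h0

/-- Complete intersections of univariate polynomials have the expected depth. -/
lemma IsLocQuot.depthGE_univIdeal {V K A : Type u} [Field K] [Fintype V] [CommRing A]
    [IsLocalRing A] {J q : Ideal (MvPolynomial V K)} {φ : MvPolynomial V K →+* A}
    (h : IsLocQuot J q φ) (hq : q.IsMaximal) {B : Finset V} {g : V → Polynomial K}
    (hJ : J ≤ univIdeal B g) {n : ℕ} (hn : n + B.card = Fintype.card V) :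
    DepthGE A (A ⧸ (univIdeal B g).map φ) n := by
  classical
  induction n generalizing B g with
  | zero => exact fun i hi => absurd hi (Nat.not_lt_zero i)
  | succ n ih =>
    obtain ⟨v, hv⟩ : ∃ v, v ∉ B := by
      by_contra! hB
      rw [Finset.eq_univ_of_forall hB, Finset.card_univ] at hn
      omega
    obtain ⟨p, hp, hpq⟩ := exists_monic_aeval_mem hq v
    have key : univIdeal (insert v B) (Function.update g v p) =
        univIdeal B g ⊔ Ideal.span {Polynomial.aeval (X v) p} := by
      rw [univIdeal, univIdeal, ← Ideal.span_union, Finset.coe_insert, Set.image_insert_eq,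
        Function.update_self, Set.union_comm, Set.singleton_union]
      congr 2
      refine Set.image_congr fun u hu => ?_
      have huv : u ≠ v := by rintro rfl; exact hv hu
      simp only [Function.update_of_ne huv]
    refine h.depthGE_succ hJ hpq (fun s => mem_univIdeal_of_mul_mem hv hp) ?_
    rw [← key]
    refine ih ?_ (by rw [Finset.card_insert_of_notMem hv]; omega)
    rw [key]
    exact hJ.trans le_sup_left

end CompleteIntersection

section Slices

open MvPolynomial

variable {V K : Type*} [Field K]

/-- The exponents of the monomial ideal `(I : X v ^ b) + (X v)`. -/
def sliceAt (Φ : Set (V →₀ ℕ)) (v : V) (b : ℕ) : Set (V →₀ ℕ) :=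
  {m | m + Finsupp.single v b ∈ Φ ∨ 1 ≤ m v}

/-- The exponents of the monomial ideal `I : X v ^ b`. -/
def colonAt (Φ : Set (V →₀ ℕ)) (v : V) (b : ℕ) : Set (V →₀ ℕ) :=
  {m | m + Finsupp.single v b ∈ Φ}

lemma isUpperSet_sliceAt {Φ : Set (V →₀ ℕ)} (hΦ : IsUpperSet Φ) (v : V) (b : ℕ) :
    IsUpperSet (sliceAt Φ v b) := fun _ _ h =>
  Or.imp (fun h' => hΦ (add_le_add_left h _) h') fun h' => h'.trans (h v)

lemma isUpperSet_colonAt {Φ : Set (V →₀ ℕ)} (hΦ : IsUpperSet Φ) (v : V) (b : ℕ) :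
    IsUpperSet (colonAt Φ v b) := fun _ _ h h' => hΦ (add_le_add_left h _) h'

lemma mem_monIdeal_colonAt {Φ : Set (V →₀ ℕ)} (hΦ : IsUpperSet Φ) (v : V)
    (f : MvPolynomial V K) : f ∈ monIdeal K (colonAt Φ v 1) ↔ f * X v ∈ monIdeal K Φ := by
  rw [mem_monIdeal (isUpperSet_colonAt hΦ v 1), mem_monIdeal hΦ, support_mul_X]
  simp [colonAt]

lemma monIdeal_sup_span_X {Φ : Set (V →₀ ℕ)} (hΦ : IsUpperSet Φ) (v : V) :
    monIdeal K Φ ⊔ Ideal.span {X v} = monIdeal K (sliceAt Φ v 0) := by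
  have hS := isUpperSet_sliceAt hΦ v 0
  apply le_antisymm
  · refine sup_le (monIdeal_le.2 fun m hm => ?_) ?_
    · rw [monomial_mem_monIdeal hS]
      exact .inl (by simpa using hm)
    · rw [Ideal.span_singleton_le_iff_mem, X, monomial_mem_monIdeal hS]
      exact .inr (by simp)
  · rw [monIdeal_le]
    rintro m (hm | hm)
    · exact Ideal.mem_sup_left ((monomial_mem_monIdeal hΦ).2 (by simpa using hm))
    · refine Ideal.mem_sup_right ?_
      have hle : Finsupp.single v 1 ≤ m := Finsupp.single_le_iff.2 hm
      rw [← tsub_add_cancel_of_le hle, ← one_mul (1 : K), ← monomial_mul]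
      exact Ideal.mul_mem_left _ _ (Ideal.mem_span_singleton_self _)

lemma IsLocQuot.depthGE_of_slices {V K A : Type u} [Field K] [CommRing A]
    [IsLocalRing A] {J q : Ideal (MvPolynomial V K)} {φ : MvPolynomial V K →+* A}
    (h : IsLocQuot J q φ) {Φ : Set (V →₀ ℕ)} (hΦ : IsUpperSet Φ) (hJ : J ≤ monIdeal K Φ)
    {v : V} {a n : ℕ}
    (hslice : ∀ b < a, DepthGE A (A ⧸ (monIdeal K (sliceAt Φ v b)).map φ) n)
    (hcolon : DepthGE A (A ⧸ (monIdeal K (colonAt Φ v a)).map φ) n) :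
    DepthGE A (A ⧸ (monIdeal K Φ).map φ) n := by
  induction a generalizing Φ with
  | zero =>
    have : colonAt Φ v 0 = Φ := by
      ext m
      simp [colonAt]
    rwa [this] at hcolon
  | succ a ih =>
    have hadd : ∀ (m : V →₀ ℕ) b, m + Finsupp.single v b + Finsupp.single v 1 =
        m + Finsupp.single v (b + 1) := fun m b => by rw [add_assoc, ← Finsupp.single_add]
    refine h.depthGE_of_colon hJ (mem_monIdeal_colonAt hΦ v) ?_
      (ih (isUpperSet_colonAt hΦ v 1) (hJ.trans (monIdeal_le.2 fun m hm => ?_)) ?_ ?_)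
    · rw [monIdeal_sup_span_X hΦ]
      exact hslice 0 a.succ_pos
    · rw [monomial_mem_monIdeal (isUpperSet_colonAt hΦ v 1)]
      exact hΦ le_self_add hm
    · intro b hb
      have : sliceAt (colonAt Φ v 1) v b = sliceAt Φ v (b + 1) := by
        ext m
        simp only [sliceAt, colonAt, Set.mem_ofPred_eq, hadd]
      rw [this]
      exact hslice (b + 1) (by omega)
    · have : colonAt (colonAt Φ v 1) v a = colonAt Φ v (a + 1) := by
        ext m
        simp only [colonAt, Set.mem_ofPred_eq, hadd]
      rwa [this]

end Slices

section StateExponents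

variable {ι : Type*} [PartialOrder ι]

/-- The exponents with values `α i` at `x i` and `β i` at `y i` of the monomials in the ideal
generated by the weighted edge ideal, the `y i` for `i ∈ F`, and the `x i ^ e` for `e ∈ c i`. -/
def StateExp (W : ι → ι → ℕ) (F : Set ι) (c : ι → Set ℕ) (α β : ι → ℕ) : Prop :=
  (∃ i ∈ F, 1 ≤ β i) ∨ (∃ i, ∃ e ∈ c i, e ≤ α i) ∨ EdgeExp W α β

/-- The states reached when slicing a weighted edge ideal along the variables `y i`. -/
structure IsState (W : ι → ι → ℕ) (F : Set ι) (c : ι → Set ℕ) : Prop where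
  isUpperSet : IsUpperSet F
  eq_empty : ∀ i ∈ F, c i = ∅
  exists_le : ∀ i j, (c i).Nonempty → j ≤ i → ∃ e ∈ c j, e ≤ W j i

/-- The powers of the `x i` that arise when slicing along `y n` at height `b`. -/
def addPowers (W : ι → ι → ℕ) (c : ι → Set ℕ) (n : ι) (b : ℕ) (i : ι) : Set ℕ :=
  c i ∪ {e | i ≤ n ∧ W i n ≤ b ∧ e = W i n}

variable {W : ι → ι → ℕ} {F : Set ι} {c : ι → Set ℕ}

lemma StateExp.mono {α β α' β' : ι → ℕ} (h : StateExp W F c α β) (hα : α ≤ α') (hβ : β ≤ β') :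
    StateExp W F c α' β' := by
  rcases h with ⟨i, hi, h⟩ | ⟨i, e, he, h⟩ | h
  · exact .inl ⟨i, hi, h.trans (hβ i)⟩
  · exact .inr (.inl ⟨i, e, he, h.trans (hα i)⟩)
  · exact .inr (.inr (h.mono hα hβ))

lemma stateExp_insert {n : ι} {α β : ι → ℕ} :
    StateExp W (insert n F) c α β ↔ StateExp W F c α β ∨ 1 ≤ β n := by
  simp only [StateExp, Set.mem_insert_iff, or_and_right, exists_or, exists_eq_left]
  exact or_assoc.trans or_comm

lemma StateExp.update [DecidableEq ι] {n : ι} (hn : n ∉ F) {b : ℕ} {α β : ι → ℕ}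
    (h : StateExp W F (addPowers W c n b) α β) :
    StateExp W F c α (Function.update β n (β n + b)) := by
  rcases h with ⟨i, hi, h⟩ | ⟨i, e, he | ⟨hin, hb, rfl⟩, h⟩ | h
  · have hin : i ≠ n := by rintro rfl; exact hn hi
    exact .inl ⟨i, hi, by rwa [Function.update_of_ne hin]⟩
  · exact .inr (.inl ⟨i, e, he, h⟩)
  · exact .inr (.inr ⟨i, n, hin, h, by rw [Function.update_self]; omega⟩)
  · exact .inr (.inr (h.mono le_rfl (le_update_self_iff.2 (Nat.le_add_right _ _))))

lemma StateExp.of_update [DecidableEq ι] {n : ι} (hn : n ∉ F) {b : ℕ} {α β : ι → ℕ}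
    (h : StateExp W F c α (Function.update β n (β n + b))) :
    StateExp W F (addPowers W c n b) α β ∨ ∃ i ≤ n, b < W i n ∧ W i n ≤ β n + b := by
  rcases h with ⟨i, hi, h⟩ | ⟨i, e, he, h⟩ | ⟨i, k, hik, h1, h2⟩
  · have hin : i ≠ n := by rintro rfl; exact hn hi
    rw [Function.update_of_ne hin] at h
    exact .inl (.inl ⟨i, hi, h⟩)
  · exact .inl (.inr (.inl ⟨i, e, .inl he, h⟩))
  · by_cases hkn : k = n
    · subst hkn
      rw [Function.update_self] at h2
      rcases le_or_gt (W i k) b with hb | hb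
      · exact .inl (.inr (.inl ⟨i, _, .inr ⟨hik, hb, rfl⟩, h1⟩))
      · exact .inr ⟨i, hik, hb, h2⟩
    · rw [Function.update_of_ne hkn] at h2
      exact .inl (.inr (.inr ⟨i, k, hik, h1, h2⟩))

lemma stateExp_slice [DecidableEq ι] {n : ι} (hn : n ∉ F) (b : ℕ) (α β : ι → ℕ) :
    StateExp W F c α (Function.update β n (β n + b)) ∨ 1 ≤ β n ↔
      StateExp W (insert n F) (addPowers W c n b) α β := by
  rw [stateExp_insert]
  refine ⟨?_, Or.imp_left (StateExp.update hn)⟩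
  rintro (h | h)
  · exact (h.of_update hn).imp_right fun ⟨i, _, h1, h2⟩ => by omega
  · exact .inr h

lemma stateExp_colon [DecidableEq ι] {n : ι} (hn : n ∉ F) {b : ℕ} (hb : ∀ i ≤ n, W i n ≤ b)
    (α β : ι → ℕ) : StateExp W F c α (Function.update β n (β n + b)) ↔
      StateExp W F (addPowers W c n b) α β :=
  ⟨fun h => (h.of_update hn).resolve_right fun ⟨i, hi, h1, _⟩ => (hb i hi).not_gt h1,
    StateExp.update hn⟩

namespace IsState

lemma empty : IsState W ∅ fun _ => ∅ :=
  ⟨isUpperSet_empty, by simp, by simp⟩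

variable (h : IsState W F c)

include h

lemma exists_le_addPowers (hleft : ∀ {i j k}, i ≤ j → j ≤ k → W i k ≤ W i j)
    (hright : ∀ {i j k}, i ≤ j → j ≤ k → W i k ≤ W j k) {n : ι} {b : ℕ} (i j : ι)
    (hi : (addPowers W c n b i).Nonempty) (hji : j ≤ i) :
    ∃ e ∈ addPowers W c n b j, e ≤ W j i := by
  obtain ⟨e, he | ⟨hin, hb, rfl⟩⟩ := hi
  · obtain ⟨e', he', hle⟩ := h.exists_le i j ⟨e, he⟩ hji
    exact ⟨e', .inl he', hle⟩
  · exact ⟨_, .inr ⟨hji.trans hin, (hright hji hin).trans hb, rfl⟩, hleft hji hin⟩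

lemma colon (hleft : ∀ {i j k}, i ≤ j → j ≤ k → W i k ≤ W i j)
    (hright : ∀ {i j k}, i ≤ j → j ≤ k → W i k ≤ W j k) {n : ι} (hn : n ∉ F) (b : ℕ) :
    IsState W F (addPowers W c n b) where
  isUpperSet := h.isUpperSet
  eq_empty i hi := by
    rw [addPowers, h.eq_empty i hi, Set.empty_union, Set.eq_empty_iff_forall_notMem]
    rintro e ⟨hin, -, -⟩
    exact hn (h.isUpperSet hin hi)
  exists_le := h.exists_le_addPowers hleft hright

lemma slice (hleft : ∀ {i j k}, i ≤ j → j ≤ k → W i k ≤ W i j)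
    (hright : ∀ {i j k}, i ≤ j → j ≤ k → W i k ≤ W j k) {n : ι} (hn : n ∉ F) (hc : c n = ∅)
    (hmax : ∀ i, n < i → i ∈ F ∨ (c i).Nonempty) {b : ℕ} (hb : b < W n n) :
    IsState W (insert n F) (addPowers W c n b) where
  isUpperSet := by
    rintro i j hij (rfl | hi)
    · rcases hij.eq_or_lt with rfl | hij'
      · exact .inl rfl
      · refine .inr ((hmax j hij').resolve_right fun hj => ?_)
        obtain ⟨e, he, -⟩ := h.exists_le j i hj hij
        simp [hc] at he
    · exact .inr (h.isUpperSet hij hi)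
  eq_empty := by
    rintro i (rfl | hi)
    · rw [addPowers, hc, Set.empty_union, Set.eq_empty_iff_forall_notMem]
      rintro e ⟨-, h', -⟩
      omega
    · exact (h.colon hleft hright hn b).eq_empty i hi
  exists_le := h.exists_le_addPowers hleft hright

lemma stateExp_iff_of_full (hW : ∀ i j, i ≤ j → 0 < W i j) (hfull : ∀ i ∉ F, (c i).Nonempty)
    (α β : ι → ℕ) : StateExp W F c α β ↔ (∃ i ∈ F, 1 ≤ β i) ∨ ∃ i ∉ F, sInf (c i) ≤ α i := by
  have hpow : ∀ i, ∀ e ∈ c i, e ≤ α i → ∃ i ∉ F, sInf (c i) ≤ α i := fun i e he hle =>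
    ⟨i, fun hi => by simp [h.eq_empty i hi] at he, (Nat.sInf_le he).trans hle⟩
  constructor
  · rintro (h1 | ⟨i, e, he, hle⟩ | ⟨i, k, hik, h1, h2⟩)
    · exact .inl h1
    · exact .inr (hpow i e he hle)
    · by_cases hk : k ∈ F
      · exact .inl ⟨k, hk, (hW i k hik).trans_le h2⟩
      · obtain ⟨e, he, hle⟩ := h.exists_le k i (hfull k hk) hik
        exact .inr (hpow i e he (hle.trans h1))
  · rintro (h1 | ⟨i, hi, hle⟩)
    · exact .inl h1
    · exact .inr (.inl ⟨i, _, Nat.sInf_mem (hfull i hi), hle⟩)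

end IsState

/-- Induction over slices: a property of exponent sets that holds for complete intersections of
powers of variables and can be checked on slices holds for the weighted edge ideal. -/
theorem IsState.induction [Finite ι] [DecidableEq ι] (hW : ∀ i j, i ≤ j → 0 < W i j)
    (hleft : ∀ {i j k}, i ≤ j → j ≤ k → W i k ≤ W i j)
    (hright : ∀ {i j k}, i ≤ j → j ≤ k → W i k ≤ W j k) {P : Set ι → (ι → Set ℕ) → Prop}
    (hbase : ∀ F c (a : ι → ℕ), IsState W F c → (∀ α β, StateExp W F c α β ↔
      (∃ i ∈ F, 1 ≤ β i) ∨ ∃ i ∉ F, a i ≤ α i) → P F c)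
    (hstep : ∀ F c n a, n ∉ F → (∀ i ≤ n, W i n ≤ a) →
      (∀ b < a, P (insert n F) (addPowers W c n b)) → P F (addPowers W c n a) → P F c)
    (h : IsState W F c) : P F c := by
  induction hU : {i | i ∉ F ∧ c i = ∅}.ncard using Nat.strong_induction_on generalizing F c with
  | _ N ih =>
  rcases Set.eq_empty_or_nonempty {i | i ∉ F ∧ c i = ∅} with h0 | h0
  · refine hbase F c _ h (h.stateExp_iff_of_full hW fun i hi => ?_)
    rw [Set.nonempty_iff_ne_empty]
    intro hc
    have : i ∈ {i | i ∉ F ∧ c i = ∅} := ⟨hi, hc⟩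
    rw [h0] at this
    exact this
  · obtain ⟨n, ⟨hn, hc⟩, hmax⟩ := (Set.toFinite {i | i ∉ F ∧ c i = ∅}).exists_maximal h0
    have hlt : ∀ {F' b}, F ⊆ F' → (n ∉ F' → addPowers W c n b n ≠ ∅) →
        {i | i ∉ F' ∧ addPowers W c n b i = ∅}.ncard < N := by
      intro F' b hF hne
      rw [← hU]
      refine Set.ncard_lt_ncard ⟨?_, fun hsub => ?_⟩
      · rintro i ⟨hi, hi'⟩
        exact ⟨fun h' => hi (hF h'), (Set.union_empty_iff.1 hi').1⟩
      · have := hsub (a := n) ⟨hn, hc⟩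
        exact hne this.1 this.2
    refine hstep F c n (W n n) hn (fun i hi => hright hi le_rfl) (fun b hb => ?_) ?_
    · refine ih _ (hlt (Set.subset_insert n F) fun h' => absurd (Set.mem_insert n F) h')
        (h.slice hleft hright hn hc (fun i hi => ?_) hb) rfl
      by_contra! hi'
      exact hi.not_ge (hmax hi' hi.le)
    · refine ih _ (hlt subset_rfl fun _ h' => ?_) (h.colon hleft hright hn _) rfl
      have : W n n ∈ addPowers W c n (W n n) n := .inr ⟨le_rfl, le_rfl, rfl⟩
      rw [h'] at this
      exact this

end StateExponents

section Weights

open MvPolynomial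

lemma monIdeal_mono {V K : Type*} [Field K] {Φ Ψ : Set (V →₀ ℕ)} (h : Φ ⊆ Ψ) :
    monIdeal K Φ ≤ monIdeal K Ψ :=
  Ideal.span_mono (Set.image_mono h)

lemma univIdeal_X_pow {V K : Type*} [Field K] (B : Finset V) (e : V → ℕ) :
    univIdeal B (fun v => (Polynomial.X ^ e v : Polynomial K)) =
      monIdeal K {m | ∃ v ∈ B, e v ≤ m v} := by
  have hup : IsUpperSet {m : V →₀ ℕ | ∃ v ∈ B, e v ≤ m v} :=
    fun _ _ h ⟨v, hv, hm⟩ => ⟨v, hv, hm.trans (h v)⟩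
  apply le_antisymm
  · rw [univIdeal, Ideal.span_le]
    rintro _ ⟨v, hv, rfl⟩
    simp only [map_pow, Polynomial.aeval_X, SetLike.mem_coe]
    rw [X_pow_eq_monomial, monomial_mem_monIdeal hup]
    exact ⟨v, hv, by simp⟩
  · rw [monIdeal_le]
    rintro m ⟨v, hv, hm⟩
    have hle : Finsupp.single v (e v) ≤ m := Finsupp.single_le_iff.2 hm
    rw [← tsub_add_cancel_of_le hle, ← one_mul (1 : K), ← monomial_mul, ← X_pow_eq_monomial]
    exact Ideal.mul_mem_left _ _ (Ideal.subset_span ⟨v, hv, by simp⟩)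

variable {V K A : Type u} [Field K] [Fintype V] [CommRing A] [IsLocalRing A]
  {q : Ideal (MvPolynomial V K)} {φ : MvPolynomial V K →+* A} {ι : Type*} [Fintype ι]
  [PartialOrder ι] {G : SimpleGraph V} {x y : ι → V} {W : ι → ι → ℕ}

lemma IsOrderedMatching.depthGE_quotient (hG : IsOrderedMatching G x y)
    (h : IsLocQuot (monIdeal K (edgeExponents x y W)) q φ) (hq : q.IsMaximal)
    (hW : ∀ i j, i ≤ j → 0 < W i j) (hleft : ∀ {i j k}, i ≤ j → j ≤ k → W i k ≤ W i j)
    (hright : ∀ {i j k}, i ≤ j → j ≤ k → W i k ≤ W j k) :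
    DepthGE A (A ⧸ (monIdeal K (edgeExponents x y W)).map φ) (Fintype.card ι) := by
  classical
  let Φ (F : Set ι) (c : ι → Set ℕ) : Set (V →₀ ℕ) :=
    {m | StateExp W F c (fun i => m (x i)) (fun i => m (y i))}
  have hup : ∀ F c, IsUpperSet (Φ F c) := fun F c m m' hle hm =>
    StateExp.mono hm (fun i => hle (x i)) (fun i => hle (y i))
  have hJ : ∀ F c, monIdeal K (edgeExponents x y W) ≤ monIdeal K (Φ F c) := fun F c =>
    monIdeal_mono fun m hm => .inr (.inr hm)
  have hshift : ∀ (m : V →₀ ℕ) n b,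
      (fun i => (m + Finsupp.single (y n) b) (x i)) = (fun i => m (x i)) ∧
      (fun i => (m + Finsupp.single (y n) b) (y i)) =
        Function.update (fun i => m (y i)) n (m (y n) + b) := by
    refine fun m n b => ⟨funext fun i => ?_, funext fun i => ?_⟩
    · simp [(hG.x_ne_y i n).symm]
    · rcases eq_or_ne i n with rfl | hin
      · simp
      · simp [hin, hG.y_injective.eq_iff]
  have h0 : Φ ∅ (fun _ => ∅) = edgeExponents x y W := by
    ext m
    simp [Φ, StateExp, edgeExponents]
  rw [← h0]
  refine IsState.induction (P := fun F c => DepthGE A (A ⧸ (monIdeal K (Φ F c)).map φ)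
    (Fintype.card ι)) hW hleft hright ?_ ?_ IsState.empty
  · intro F c a _ hF
    obtain ⟨e, rfl, hey⟩ := hG.exists_exponent a 1
    let f : ι → V := fun i => if i ∈ F then y i else x i
    have hf : Function.Injective f := by
      intro i j hij
      by_cases hi : i ∈ F <;> by_cases hj : j ∈ F <;> simp only [f, hi, hj, if_true, if_false] at hij
      · exact hG.y_injective hij
      · exact absurd hij.symm (hG.x_ne_y _ _)
      · exact absurd hij (hG.x_ne_y _ _)
      · exact hG.x_injective hij
    have key : Φ F c = {m | ∃ v ∈ Finset.univ.image f, e v ≤ m v} := by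
      ext m
      refine (hF _ _).trans ?_
      have hey' : ∀ i, e (y i) = 1 := congrFun hey
      simp only [Set.mem_ofPred_eq, Finset.mem_image, Finset.mem_univ, true_and,
        exists_exists_eq_and]
      constructor
      · rintro (⟨i, hi, hm⟩ | ⟨i, hi, hm⟩)
        · exact ⟨i, by simpa [f, hi, hey'] using hm⟩
        · exact ⟨i, by simpa [f, hi] using hm⟩
      · rintro ⟨i, hm⟩
        by_cases hi : i ∈ F
        · exact .inl ⟨i, hi, by simpa [f, hi, hey'] using hm⟩
        · exact .inr ⟨i, hi, by simpa [f, hi] using hm⟩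
    have hJ' := hJ F c
    rw [key, ← univIdeal_X_pow] at hJ' ⊢
    refine h.depthGE_univIdeal hq hJ' ?_
    rw [Finset.card_image_of_injective _ hf, Finset.card_univ, hG.card_eq]
  · intro F c n a hn ha hslice hcolon
    refine h.depthGE_of_slices (hup F c) (hJ F c) (v := y n) (a := a) (fun b hb => ?_) ?_
    · have : sliceAt (Φ F c) (y n) b = Φ (insert n F) (addPowers W c n b) := by
        ext m
        simp only [sliceAt, Φ, Set.mem_ofPred_eq, hshift]
        exact stateExp_slice hn b _ _
      rw [this]
      exact hslice b hb
    · have : colonAt (Φ F c) (y n) a = Φ F (addPowers W c n a) := by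
        ext m
        simp only [colonAt, Φ, Set.mem_ofPred_eq, hshift]
        exact stateExp_colon hn ha _ _
      rwa [this]

end Weights

section Main

open MvPolynomial

variable {V K : Type u} [Field K] [Fintype V] {ι : Type*} [PartialOrder ι] {G : SimpleGraph V} {x y : ι → V} {W : ι → ι → ℕ}

/-- Associated primes in the Cohen-Macaulay case are generated by variables. -/
lemma exists_eq_varIdeal_of_isCohenMacaulayRing (hW : ∀ i j, i ≤ j → 0 < W i j)
    (hCM : IsCohenMacaulayRing (MvPolynomial V K ⧸ monIdeal K (edgeExponents x y W)))
    {P : Ideal (MvPolynomial V K)} (hP : P ∈ associatedPrimes (MvPolynomial V K)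
      (MvPolynomial V K ⧸ monIdeal K (edgeExponents x y W))) :
    ∃ C : Finset V, P = varIdeal K C ∧ ∀ i j, i ≤ j → x i ∈ C ∨ y j ∈ C := by
  classical
  have hPp := hP.1
  have hJP : monIdeal K (edgeExponents x y W) ≤ P := by
    have := hP.annihilator_le
    rwa [Submodule.annihilator_top, Ideal.annihilator_quotient] at this
  have hC : ∀ i j, i ≤ j → x i ∈ Finset.univ.filter (fun v => X v ∈ P) ∨
      y j ∈ Finset.univ.filter (fun v => X v ∈ P) := fun i j hij => by
    simpa using X_mem_or_X_mem_of_le hPp hJP hij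
  refine ⟨_, ?_, hC⟩
  by_contra hne
  obtain ⟨q, hq, hPq⟩ := Ideal.exists_le_maximal P hPp.ne_top
  obtain ⟨A, _, _, _, φ, h, d, hd, hD⟩ := hCM.exists_isLocQuot hq (hJP.trans hPq)
  have hlt : varPrime K (Finset.univ.filter fun v => X v ∈ P) < ⟨P, hPp⟩ :=
    lt_of_le_of_ne (varIdeal_le.2 (by simp)) fun e => hne (congrArg PrimeSpectrum.asIdeal e).symm
  have hlt' := h.map_lt_map hlt (monIdeal_le_varIdeal hW hC) hPq
  have h1 := hD.le_coheight (P := ⟨P.map φ, h.isPrime_map hPp hJP hPq⟩)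
    (h.map_mem_associatedPrimes hP hPq)
  have h2 := Order.coheight_add_one_le hlt'
  have h3 := (add_le_add_left h1 1).trans h2
  have h4 : ((d + 1 : ℕ) : WithBot ℕ∞) ≤ (d : ℕ) := by
    rw [← hd]
    refine le_trans ?_ (Order.coheight_le_krullDim (⟨_, h.isPrime_map (isPrime_varIdeal _)
      (monIdeal_le_varIdeal hW hC) (le_trans (varIdeal_le.2 (by simp)) hPq)⟩ : PrimeSpectrum A))
    exact_mod_cast h3
  have h5 : d + 1 ≤ d := by exact_mod_cast h4
  omega

lemma isUnmixedIdeal_of_isCohenMacaulayRing [Fintype ι] (hW : ∀ i j, i ≤ j → 0 < W i j)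
    (hCM : IsCohenMacaulayRing (MvPolynomial V K ⧸ monIdeal K (edgeExponents x y W))) :
    IsUnmixedIdeal (monIdeal K (edgeExponents x y W)) := by
  classical
  have hq : ∀ v, X v ∈ RingHom.ker (constantCoeff : MvPolynomial V K →+* K) := by simp
  have hle : ∀ C, varIdeal K C ≤ RingHom.ker (constantCoeff : MvPolynomial V K →+* K) :=
    fun C => varIdeal_le.2 fun v _ => hq v
  obtain ⟨A, _, _, _, φ, h, d, hd, hD⟩ := hCM.exists_isLocQuot (isMaximal_ker_constantCoeff V K)
    ((monIdeal_le_varIdeal hW fun i _ _ => .inl (Finset.mem_image_of_mem x (Finset.mem_univ i))).trans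
      (hle _))
  have key : ∀ P ∈ associatedPrimes (MvPolynomial V K)
      (MvPolynomial V K ⧸ monIdeal K (edgeExponents x y W)), ∀ Q ∈ associatedPrimes (MvPolynomial V K)
      (MvPolynomial V K ⧸ monIdeal K (edgeExponents x y W)), idealHeight P ≤ idealHeight Q := by
    intro P hP Q hQ
    obtain ⟨B, rfl, hB⟩ := exists_eq_varIdeal_of_isCohenMacaulayRing hW hCM hP
    obtain ⟨C, rfl, hC⟩ := exists_eq_varIdeal_of_isCohenMacaulayRing hW hCM hQ
    have h1 := h.card_le_card_add hq (k := 0) hd.le hD (monIdeal_le_varIdeal hW hC)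
      (h.map_mem_associatedPrimes hP (hle B)) (B := B)
      fun v hv => Ideal.mem_map_of_mem φ (X_mem_varIdeal hv)
    have e1 := idealHeight_eq (varPrime K B)
    have e2 := idealHeight_eq (varPrime K C)
    rw [height_varPrime] at e1 e2
    rw [show idealHeight (varIdeal K B) = _ from e1, show idealHeight (varIdeal K C) = _ from e2]
    exact_mod_cast h1
  exact fun P hP Q hQ => le_antisymm (key P hP Q hQ) (key Q hQ P hP)

namespace IsOrderedMatching

variable [Fintype ι] (hG : IsOrderedMatching G x y)

include hG

lemma isCohenMacaulayRing (hW : ∀ i j, i ≤ j → 0 < W i j)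
    (hleft : ∀ {i j k}, i ≤ j → j ≤ k → W i k ≤ W i j)
    (hright : ∀ {i j k}, i ≤ j → j ≤ k → W i k ≤ W j k) :
    IsCohenMacaulayRing (MvPolynomial V K ⧸ monIdeal K (edgeExponents x y W)) := by
  classical
  intro p hp
  have h := isLocQuot_atPrime (monIdeal K (edgeExponents x y W)) p
  have hN : IsNoetherianRing (Localization.AtPrime p) :=
    IsLocalization.isNoetherianRing p.primeCompl _ inferInstance
  have hD := hG.depthGE_quotient h
    (Ideal.comap_isMaximal_of_surjective _ Ideal.Quotient.mk_surjective) hW hleft hright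
  have hbot := (Ideal.map_eq_bot_iff_le_ker _).2 fun s hs => h.apply_eq_zero s hs
  rw [hbot] at hD
  refine depth_eq_of_depthGE (hD.of_equiv (Submodule.quotEquivOfEqBot ⊥ rfl))
    (h.ringKrullDim_le fun P hP hJ => ⟨Finset.univ.filter fun v => X v ∈ P, by simp, ?_⟩)
  have := card_add_card_le_of_pairs hG.bijective.1 (B := Finset.univ.filter fun v => X v ∈ P)
    (T := ∅) (fun i => by simpa using X_mem_or_X_mem_of_le hP hJ le_rfl) (by simp)
  rw [hG.card_eq]
  simpa using this

end IsOrderedMatching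

end Main

/-- For a Cohen-Macaulay bipartite graph `G` with an edge weight `w`, the edge-weighted
edge ideal `I(G_w)` is unmixed if and only if `S/I(G_w)` is Cohen-Macaulay. -/
theorem weighted_unmixed_iff_CM_of_bipartite {V : Type u} [Fintype V]
    (K : Type u) [Field K] (G : SimpleGraph V) (hbip : IsBipartite G) (hiso : HasNoIsolatedVertices G)
    (hCM : IsCohenMacaulayRing (MvPolynomial V K ⧸ edgeIdeal K G))
    (w : Sym2 V → ℕ) (hw : ∀ e ∈ G.edgeSet, 0 < w e) :
    IsUnmixedIdeal (weightedEdgeIdeal K G w) ↔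
      IsCohenMacaulayRing (MvPolynomial V K ⧸ weightedEdgeIdeal K G w) := by
  classical
  obtain ⟨ι, _, _, x, y, hG⟩ := exists_isOrderedMatching hbip hiso hCM
  have hW : ∀ i j, i ≤ j → 0 < w s(x i, y j) := fun i j hij => hw _ ((hG.adj_iff i j).2 hij)
  rw [hG.weightedEdgeIdeal_eq]
  refine ⟨fun h => ?_, isUnmixedIdeal_of_isCohenMacaulayRing hW⟩
  have hreg := hG.pairRegular_of_isUnmixed hW h
  exact hG.isCohenMacaulayRing hW (hreg.le_left hW) (hreg.le_right hW)
end

section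
/- Every unmixed bipartite graph without isolated vertices is very well-covered; that is, if G is a bipartite graph without isolated vertices all of whose minimal vertex covers have the same cardinality, then |V(G)| is even and every maximal independent set of G has cardinality |V(G)|/2. -/
/-- An independent set in a graph. -/
def IsIndepSet {V : Type*} (G : SimpleGraph V) (A : Set V) : Prop :=
  A.Pairwise fun u v => ¬ G.Adj u v

/-- A maximal independent set in a graph. -/
def IsMaxIndepSet {V : Type*} (G : SimpleGraph V) (A : Set V) : Prop :=
  IsIndepSet G A ∧ ∀ B, IsIndepSet G B → A ⊆ B → A = B

/-- A vertex cover of a graph. -/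
def IsVertexCover {V : Type*} (G : SimpleGraph V) (C : Set V) : Prop :=
  ∀ ⦃u v⦄, G.Adj u v → u ∈ C ∨ v ∈ C

/-- A minimal vertex cover of a graph. -/
def IsMinVertexCover {V : Type*} (G : SimpleGraph V) (C : Set V) : Prop :=
  IsVertexCover G C ∧ ∀ B ⊆ C, IsVertexCover G B → B = C

/-- A graph is very well-covered if it has no isolated vertices, an even number of
vertices, and every maximal independent set has cardinality half the number of vertices. -/
def IsVeryWellCovered {V : Type*} [Fintype V] (G : SimpleGraph V) : Prop :=
  HasNoIsolatedVertices G ∧ Even (Fintype.card V) ∧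
    ∀ A : Set V, IsMaxIndepSet G A → A.ncard = Fintype.card V / 2

/-- Condition (*) for a graph on the `2h` vertices `x_1, …, x_h, y_1, …, y_h`
(encoded as `Sum.inl 0, …, Sum.inl (h-1), Sum.inr 0, …, Sum.inr (h-1)`):
`X = {x_1, …, x_h}` is a minimal vertex cover, `Y = {y_1, …, y_h}` is a maximal
independent set, and `x_i y_i` is an edge for every `i`. -/
def CondStar {h : ℕ} (G : SimpleGraph (Fin h ⊕ Fin h)) : Prop :=
  IsMinVertexCover G (Set.range Sum.inl) ∧
    IsMaxIndepSet G (Set.range Sum.inr) ∧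
    ∀ i : Fin h, G.Adj (Sum.inl i) (Sum.inr i)

/-- A graph is unmixed if all its minimal vertex covers have the same cardinality. -/
def IsUnmixedGraph {V : Type*} (G : SimpleGraph V) : Prop :=
  ∀ C₁ C₂ : Set V, IsMinVertexCover G C₁ → IsMinVertexCover G C₂ → C₁.ncard = C₂.ncard

/-- The complement of a maximal independent set is a minimal vertex cover. -/
theorem IsMaxIndepSet.isMinVertexCover_compl {V : Type*} {G : SimpleGraph V} {A : Set V}
    (hA : IsMaxIndepSet G A) : IsMinVertexCover G Aᶜ := by
  refine ⟨fun u v huv => ?_, fun B hB hcov => ?_⟩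
  · by_contra! h
    simp only [Set.mem_compl_iff, not_not] at h
    exact hA.1 h.1 h.2 huv.ne huv
  · have h := hA.2 Bᶜ
      (fun u hu v hv _ huv => (hcov huv).elim hu hv) (Set.subset_compl_comm.mp hB)
    rw [h, compl_compl]

/-- Without isolated vertices, each side of a bipartition is a minimal vertex cover. -/
theorem isMinVertexCover_of_bipartition {V : Type*} {G : SimpleGraph V} {A : Set V}
    (hA : ∀ ⦃u v⦄, G.Adj u v → (u ∈ A ↔ v ∉ A)) (hiso : HasNoIsolatedVertices G) :
    IsMinVertexCover G A := by
  refine ⟨fun u v huv => ?_, fun B hB hcov => hB.antisymm fun a ha => ?_⟩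
  · by_cases hv : v ∈ A
    · exact Or.inr hv
    · exact Or.inl ((hA huv).mpr hv)
  · obtain ⟨u, hu⟩ := hiso a
    exact (hcov hu).resolve_right fun h => (hA hu).mp ha (hB h)

/-- Every unmixed bipartite graph without isolated vertices is very well-covered. -/
theorem veryWellCovered_of_unmixed_bipartite {V : Type*} [Fintype V]
    (G : SimpleGraph V) (hbip : IsBipartite G) (hiso : HasNoIsolatedVertices G)
    (hunm : IsUnmixedGraph G) :
    IsVeryWellCovered G := by
  obtain ⟨A, hA⟩ := hbip
  have hcover := isMinVertexCover_of_bipartition hA hiso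
  have hcover' : IsMinVertexCover G Aᶜ :=
    isMinVertexCover_of_bipartition (fun u v huv => not_congr (hA huv)) hiso
  have hsides := hunm A Aᶜ hcover hcover'
  have hcard := Set.ncard_add_ncard_compl A
  rw [Nat.card_eq_fintype_card] at hcard
  refine ⟨hiso, ⟨A.ncard, by omega⟩, fun S hS => ?_⟩
  have hS_cover := hunm Sᶜ A hS.isMinVertexCover_compl hcover
  have hS_card := Set.ncard_add_ncard_compl S
  rw [Nat.card_eq_fintype_card] at hS_card
  omega
end

section
/- Let G be a very well-covered graph with 2h vertices, labeled so that condition (*) holds: V(G) is the disjoint union of the minimal vertex cover X = {x_1,…,x_h} and the maximal independent set Y = {y_1,…,y_h} with x_i y_i ∈ E(G) for all i. Let w : E(G) → Z_{>0} be an edge weight such that the edge-weighted edge ideal I(G_w) is unmixed. Then every associated prime p of S/I(G_w) has height h, and for every integer k with 1 ≤ k ≤ h, exactly one of the variables x_k and y_k belongs to p. -/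
open MvPolynomial in
/-- An ideal generated by variables is the kernel of the substitution killing them. -/
theorem span_X_image_eq_ker {σ R : Type*} [CommRing R] (s : Set σ) [DecidablePred (· ∈ s)] :
    Ideal.span (X '' s : Set (MvPolynomial σ R)) =
      RingHom.ker (aeval (R := R) fun v => if v ∈ s then (0 : MvPolynomial σ R) else X v) := by
  apply le_antisymm
  · rw [Ideal.span_le]
    rintro _ ⟨v, hv, rfl⟩
    simp [hv]
  · intro f hf
    have key : (Ideal.Quotient.mkₐ R (Ideal.span (X '' s : Set (MvPolynomial σ R)))).comp
        (aeval fun v => if v ∈ s then (0 : MvPolynomial σ R) else X v) =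
        Ideal.Quotient.mkₐ R (Ideal.span (X '' s)) := by
      ext v
      by_cases hv : v ∈ s
      · have hX : (X v : MvPolynomial σ R) ∈ Ideal.span (X '' s : Set (MvPolynomial σ R)) :=
          Ideal.subset_span ⟨v, hv, rfl⟩
        simp [hv, Ideal.Quotient.eq_zero_iff_mem.mpr hX]
      · simp [hv]
    have hf' := DFunLike.congr_fun key f
    rw [AlgHom.comp_apply, (RingHom.mem_ker).mp hf, map_zero] at hf'
    exact Ideal.Quotient.eq_zero_iff_mem.mp hf'.symm

open MvPolynomial in
theorem isPrime_span_X_image {σ R : Type*} [CommRing R] [IsDomain R] (s : Set σ) :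
    (Ideal.span (X '' s : Set (MvPolynomial σ R))).IsPrime := by
  classical
  rw [span_X_image_eq_ker]
  exact RingHom.ker_isPrime _

open MvPolynomial in
theorem X_mem_span_X_image_iff {σ R : Type*} [CommRing R] [Nontrivial R] {s : Set σ} {v : σ} :
    (X v : MvPolynomial σ R) ∈ Ideal.span (X '' s : Set (MvPolynomial σ R)) ↔ v ∈ s := by
  classical
  refine ⟨fun hv => ?_, fun hv => Ideal.subset_span ⟨v, hv, rfl⟩⟩
  by_contra hvs
  rw [span_X_image_eq_ker, RingHom.mem_ker] at hv
  simp [hvs] at hv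

open MvPolynomial in
theorem card_le_height_span_X_image {σ R : Type*} [CommRing R] [IsDomain R] (s : Finset σ) :
    (s.card : ℕ∞) ≤ (Ideal.span (X '' (s : Set σ) : Set (MvPolynomial σ R))).height := by
  classical
  induction s using Finset.induction_on with
  | empty => simp
  | insert a s ha ih =>
    have := isPrime_span_X_image (R := R) (s : Set σ)
    have := isPrime_span_X_image (R := R) ((insert a s : Finset σ) : Set σ)
    have hlt : Ideal.span (X '' (s : Set σ) : Set (MvPolynomial σ R)) <
        Ideal.span (X '' ((insert a s : Finset σ) : Set σ)) := by
      refine lt_of_le_of_ne (Ideal.span_mono (Set.image_mono (by simp))) fun heq => ha ?_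
      have hX : (X a : MvPolynomial σ R) ∈
          Ideal.span (X '' ((insert a s : Finset σ) : Set σ)) :=
        X_mem_span_X_image_iff.mpr (by simp)
      rw [← heq, X_mem_span_X_image_iff] at hX
      exact hX
    rw [Finset.card_insert_of_notMem ha, Nat.cast_add, Nat.cast_one]
    exact (add_le_add_left ih 1).trans (Ideal.height_add_one_le_of_lt_of_isPrime hlt)

theorem idealHeight_eq_height {R : Type*} [CommRing R] (p : Ideal R) [hp : p.IsPrime] :
    idealHeight p = (p.height : WithBot ℕ∞) := by
  rw [show p = (⟨p, hp⟩ : PrimeSpectrum R).asIdeal from rfl, PrimeSpectrum.height_eq_orderHeight,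
    Order.height_eq_krullDim_Iic]
  rfl

open MvPolynomial in
theorem X_mem_or_X_mem_of_adj {V K : Type*} [Field K] {G : SimpleGraph V} {w : Sym2 V → ℕ}
    {p : Ideal (MvPolynomial V K)} [hp : p.IsPrime] (hI : weightedEdgeIdeal K G w ≤ p) {u v : V}
    (huv : G.Adj u v) : X u ∈ p ∨ X v ∈ p := by
  have hmem : edgeMonomial K w s(u, v) ∈ p := hI (Ideal.subset_span ⟨_, huv, rfl⟩)
  exact hp.mem_or_mem (hp.mem_of_pow_mem _ hmem)

open MvPolynomial in
theorem weightedEdgeIdeal_le_span_X_image {V K : Type*} [Field K] {G : SimpleGraph V}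
    {w : Sym2 V → ℕ} (hw : ∀ e ∈ G.edgeSet, 0 < w e) {C : Set V} (hC : IsVertexCover G C) :
    weightedEdgeIdeal K G w ≤ Ideal.span (X '' C) := by
  rw [weightedEdgeIdeal, Ideal.span_le]
  rintro _ ⟨e, he, rfl⟩
  induction e using Sym2.ind with
  | h u v =>
    refine Ideal.pow_mem_of_mem _ ?_ _ (hw _ he)
    rcases hC he with h | h
    · exact Ideal.mul_mem_right _ _ (Ideal.subset_span ⟨u, h, rfl⟩)
    · exact Ideal.mul_mem_left _ _ (Ideal.subset_span ⟨v, h, rfl⟩)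

/-- A cover containing exactly one end of each edge of a perfect matching spans a minimal prime. -/
theorem span_X_inl_mem_minimalPrimes {h : ℕ} {K : Type*} [Field K]
    {G : SimpleGraph (Fin h ⊕ Fin h)} (hcov : IsVertexCover G (Set.range Sum.inl))
    (hadj : ∀ i : Fin h, G.Adj (Sum.inl i) (Sum.inr i))
    {w : Sym2 (Fin h ⊕ Fin h) → ℕ} (hw : ∀ e ∈ G.edgeSet, 0 < w e) :
    Ideal.span (MvPolynomial.X '' Set.range Sum.inl) ∈ (weightedEdgeIdeal K G w).minimalPrimes := by
  refine ⟨⟨isPrime_span_X_image _, weightedEdgeIdeal_le_span_X_image hw hcov⟩, ?_⟩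
  rintro q ⟨hq, hIq⟩ hle
  rw [Ideal.span_le]
  rintro _ ⟨_, ⟨i, rfl⟩, rfl⟩
  refine (X_mem_or_X_mem_of_adj hIq (hadj i)).resolve_right fun hi => ?_
  simpa using X_mem_span_X_image_iff.mp (hle hi)

theorem height_span_X_inl {h : ℕ} (K : Type*) [Field K] :
    (Ideal.span (MvPolynomial.X '' Set.range Sum.inl :
      Set (MvPolynomial (Fin h ⊕ Fin h) K))).height = h := by
  classical
  have hprime := isPrime_span_X_image (R := K) (Set.range (Sum.inl : Fin h → Fin h ⊕ Fin h))
  apply le_antisymm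
  · refine (Ideal.height_le_card_of_mem_minimalPrimes_span (Set.toFinite _)
      (p := Ideal.span (MvPolynomial.X '' Set.range Sum.inl))
      ⟨⟨hprime, le_rfl⟩, fun _ hq _ => hq.2⟩).trans ?_
    rw [Set.ncard_image_of_injective _ MvPolynomial.X_injective, Set.ncard_range_of_injective
      Sum.inl_injective]
    simp
  · have := card_le_height_span_X_image (R := K)
      (Finset.univ.map (Function.Embedding.inl : Fin h ↪ Fin h ⊕ Fin h))
    simpa using this

/-- If `G` is a very well-covered graph with `2h` vertices labeled so that condition (*)
holds and `w` is an edge weight such that `I(G_w)` is unmixed, then every associated prime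
of `S ⧸ I(G_w)` has height `h` and contains exactly one of the variables `x_k`, `y_k`
for every `k`. -/
theorem associatedPrimes_of_unmixed_weighted {h : ℕ} (K : Type*) [Field K]
    (G : SimpleGraph (Fin h ⊕ Fin h)) (hvwc : IsVeryWellCovered G) (hstar : CondStar G)
    (w : Sym2 (Fin h ⊕ Fin h) → ℕ) (hw : ∀ e ∈ G.edgeSet, 0 < w e)
    (hunm : IsUnmixedIdeal (weightedEdgeIdeal K G w)) :
    ∀ p ∈ associatedPrimes (MvPolynomial (Fin h ⊕ Fin h) K)
        (MvPolynomial (Fin h ⊕ Fin h) K ⧸ weightedEdgeIdeal K G w),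
      idealHeight p = (h : WithBot ℕ∞) ∧
        ∀ k : Fin h, Xor' (MvPolynomial.X (Sum.inl k) ∈ p)
          (MvPolynomial.X (Sum.inr k) ∈ p) := by
  classical
  obtain ⟨⟨hcov, -⟩, -, hadj⟩ := hstar
  intro p hp
  have hprime : p.IsPrime := hp.isPrime
  have hIp : weightedEdgeIdeal K G w ≤ p := by
    have hann := hp.annihilator_le
    rwa [Submodule.annihilator_top, Ideal.annihilator_quotient] at hann
  have hX : Ideal.span (MvPolynomial.X '' Set.range Sum.inl) ∈
      associatedPrimes (MvPolynomial (Fin h ⊕ Fin h) K)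
        (MvPolynomial (Fin h ⊕ Fin h) K ⧸ weightedEdgeIdeal K G w) := by
    apply Module.associatedPrimes.minimalPrimes_annihilator_subset_associatedPrimes
    rw [Ideal.annihilator_quotient]
    exact span_X_inl_mem_minimalPrimes hcov hadj hw
  have hheight : idealHeight p = (h : WithBot ℕ∞) := by
    have hXprime := hX.isPrime
    rw [hunm p hp _ hX, idealHeight_eq_height, height_span_X_inl]
    rfl
  refine ⟨hheight, fun k => (xor_iff_or_and_not_and _ _).mpr
    ⟨X_mem_or_X_mem_of_adj hIp (hadj k), fun ⟨hxk, hyk⟩ => ?_⟩⟩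
  have hchoice : ∀ i : Fin h, ∃ v : Fin h ⊕ Fin h, MvPolynomial.X v ∈ p ∧
      Sum.elim id id v = i ∧ v ≠ Sum.inr k := by
    intro i
    by_cases hik : i = k
    · exact ⟨Sum.inl i, hik ▸ hxk, rfl, Sum.inl_ne_inr⟩
    · rcases X_mem_or_X_mem_of_adj hIp (hadj i) with hi | hi
      · exact ⟨Sum.inl i, hi, rfl, Sum.inl_ne_inr⟩
      · exact ⟨Sum.inr i, hi, rfl, fun heq => hik (Sum.inr_injective heq)⟩
  choose f hfp hfi hfk using hchoice
  have hfinj : Function.Injective f := Function.LeftInverse.injective hfi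
  set s : Finset (Fin h ⊕ Fin h) := insert (Sum.inr k) (Finset.univ.image f) with hs
  have hcard : s.card = h + 1 := by
    rw [hs, Finset.card_insert_of_notMem (by simpa using hfk),
      Finset.card_image_of_injective _ hfinj, Finset.card_univ, Fintype.card_fin]
  have hle : Ideal.span (MvPolynomial.X '' (s : Set (Fin h ⊕ Fin h))) ≤ p := by
    rw [Ideal.span_le]
    rintro _ ⟨v, hv, rfl⟩
    rcases Finset.mem_insert.mp hv with rfl | hv
    · exact hyk
    · obtain ⟨i, -, rfl⟩ := Finset.mem_image.mp hv
      exact hfp i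
  have hlt := (card_le_height_span_X_image s).trans (Ideal.height_mono hle)
  have hph : p.height = h := by
    rw [idealHeight_eq_height] at hheight
    exact_mod_cast hheight
  rw [hcard, hph] at hlt
  exact absurd (Nat.cast_le.mp hlt) (by simp)
end

section
/- Let G be a very well-covered graph with 2h vertices, labeled so that condition (*) holds, and let w : E(G) → Z_{>0} be an edge weight. Then for every k with 1 ≤ k ≤ h there is a ring isomorphism (S/I(G_w))/(x_k − y_k) ≅ (S/I(O_k(G_w)))/(x_k − y_k). -/
/-- The set `N_i = {k : x_k y_i ∈ E(G)} \ {i}`. -/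
def Nset {h : ℕ} (G : SimpleGraph (Fin h ⊕ Fin h)) (i : Fin h) : Set (Fin h) :=
  {k | G.Adj (Sum.inl k) (Sum.inr i) ∧ k ≠ i}

/-- The base graph `O_i(G) = G - {x_k y_i : k ∈ N_i} + {x_k x_i : k ∈ N_i}`. -/
def Ograph {h : ℕ} (G : SimpleGraph (Fin h ⊕ Fin h)) (i : Fin h) :
    SimpleGraph (Fin h ⊕ Fin h) :=
  SimpleGraph.fromEdgeSet
    ((G.edgeSet \ {e | ∃ k ∈ Nset G i, e = s(Sum.inl k, Sum.inr i)}) ∪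
      {e | ∃ k ∈ Nset G i, e = s(Sum.inl k, Sum.inl i)})

open scoped Classical in
/-- The weight `w'` on `O_i(G)`: `w'(x_k x_i) = w(x_k y_i)` for `k ∈ N_i`, and `w' = w`
on all other edges. -/
noncomputable def Oweight {h : ℕ} (G : SimpleGraph (Fin h ⊕ Fin h))
    (w : Sym2 (Fin h ⊕ Fin h) → ℕ) (i : Fin h) : Sym2 (Fin h ⊕ Fin h) → ℕ :=
  fun e =>
    if hk : ∃ k ∈ Nset G i, e = s(Sum.inl k, Sum.inl i) then
      w s(Sum.inl hk.choose, Sum.inr i)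
    else w e

/-- Every independent set of a finite graph extends to a maximal one. -/
theorem IsIndepSet.exists_isMaxIndepSet_superset {V : Type*} [Finite V] {G : SimpleGraph V}
    {A : Set V} (hA : IsIndepSet G A) : ∃ B, A ⊆ B ∧ IsMaxIndepSet G B := by
  obtain ⟨B, hAB, hB⟩ := Finite.exists_le_maximal (p := IsIndepSet G) hA
  exact ⟨B, hAB, hB.prop, fun C hC hBC => hBC.antisymm (hB.le_of_ge hC hBC)⟩

/-- In a very well-covered graph with perfect matching `x_i y_i`, every maximal independent
set meets every matching edge. -/
theorem IsVeryWellCovered.inl_mem_or_inr_mem {h : ℕ} {G : SimpleGraph (Fin h ⊕ Fin h)}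
    (hG : IsVeryWellCovered G) (hadj : ∀ i : Fin h, G.Adj (Sum.inl i) (Sum.inr i))
    {A : Set (Fin h ⊕ Fin h)} (hA : IsMaxIndepSet G A) (k : Fin h) :
    Sum.inl k ∈ A ∨ Sum.inr k ∈ A := by
  have hcard : A.ncard = h := by
    rw [hG.2.2 A hA, Fintype.card_sum, Fintype.card_fin]
    omega
  have hinj : Set.InjOn (Sum.elim id id : Fin h ⊕ Fin h → Fin h) A := by
    rintro (i | i) hi (j | j) hj hij <;> obtain rfl : i = j := hij
    · rfl
    · exact absurd (hadj i) (hA.1 hi hj Sum.inl_ne_inr)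
    · exact absurd (hadj i) (hA.1 hj hi Sum.inl_ne_inr)
    · rfl
  have himage : (Sum.elim id id : Fin h ⊕ Fin h → Fin h) '' A = Set.univ := by
    apply Set.eq_of_subset_of_ncard_le (Set.subset_univ _)
    rw [hinj.ncard_image, hcard, Set.ncard_univ, Nat.card_eq_fintype_card,
      Fintype.card_fin]
  obtain ⟨a, ha, hak⟩ : k ∈ (Sum.elim id id : Fin h ⊕ Fin h → Fin h) '' A := by
    rw [himage]; trivial
  rcases a with i | i <;> obtain rfl : i = k := hak
  · exact Or.inl ha
  · exact Or.inr ha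

/-- In a very well-covered graph with perfect matching `x_i y_i`, no vertex is adjacent to
both ends of a matching edge. -/
theorem IsVeryWellCovered.not_adj_inl_of_adj_inr {h : ℕ} {G : SimpleGraph (Fin h ⊕ Fin h)}
    (hG : IsVeryWellCovered G) (hadj : ∀ i : Fin h, G.Adj (Sum.inl i) (Sum.inr i))
    {v : Fin h ⊕ Fin h} {k : Fin h} (hv : G.Adj v (Sum.inr k)) : ¬ G.Adj v (Sum.inl k) := by
  intro hv'
  obtain ⟨A, hvA, hA⟩ := IsIndepSet.exists_isMaxIndepSet_superset (G := G) (A := {v})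
    (Set.pairwise_singleton _ _)
  have hvA : v ∈ A := hvA rfl
  rcases hG.inl_mem_or_inr_mem hadj hA k with hk | hk
  · exact hA.1 hvA hk hv'.ne hv'
  · exact hA.1 hvA hk hv.ne hv

theorem Oweight_of_mem {h : ℕ} {G : SimpleGraph (Fin h ⊕ Fin h)}
    (w : Sym2 (Fin h ⊕ Fin h) → ℕ) {i m : Fin h} (hm : m ∈ Nset G i) :
    Oweight G w i s(Sum.inl m, Sum.inl i) = w s(Sum.inl m, Sum.inr i) := by
  have hex : ∃ k ∈ Nset G i,
      (s(Sum.inl m, Sum.inl i) : Sym2 (Fin h ⊕ Fin h)) = s(Sum.inl k, Sum.inl i) := ⟨m, hm, rfl⟩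
  have hchoose : hex.choose = m := by
    have hspec := hex.choose_spec.2
    rw [Sym2.congr_left] at hspec
    exact (Sum.inl_injective hspec).symm
  rw [Oweight, dif_pos hex, hchoose]

theorem Oweight_of_mem_edgeSet {h : ℕ} {G : SimpleGraph (Fin h ⊕ Fin h)}
    (hG : IsVeryWellCovered G) (hadj : ∀ i : Fin h, G.Adj (Sum.inl i) (Sum.inr i))
    (w : Sym2 (Fin h ⊕ Fin h) → ℕ) (i : Fin h) {e : Sym2 (Fin h ⊕ Fin h)}
    (he : e ∈ G.edgeSet) : Oweight G w i e = w e := by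
  refine dif_neg ?_
  rintro ⟨m, hm, rfl⟩
  exact hG.not_adj_inl_of_adj_inr hadj hm.1 he

theorem mem_edgeSet_Ograph {h : ℕ} {G : SimpleGraph (Fin h ⊕ Fin h)} {i : Fin h}
    {e : Sym2 (Fin h ⊕ Fin h)} :
    e ∈ (Ograph G i).edgeSet ↔
      (e ∈ G.edgeSet ∧ ¬ ∃ k ∈ Nset G i, e = s(Sum.inl k, Sum.inr i)) ∨
        ∃ k ∈ Nset G i, e = s(Sum.inl k, Sum.inl i) := by
  rw [Ograph, SimpleGraph.edgeSet_fromEdgeSet]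
  constructor
  · exact fun he => he.1
  · refine fun he => ⟨he, fun hdiag => ?_⟩
    rcases he with he | ⟨k, hk, rfl⟩
    · exact G.not_isDiag_of_mem_edgeSet he.1 hdiag
    · exact hk.2 (Sum.inl_injective hdiag)

/-- The monomials attached to two edges `a b` and `a c` of equal weight agree modulo
`X b - X c`. -/
theorem edgeMonomial_sub_edgeMonomial_mem {V : Type*} (K : Type*) [CommRing K]
    {w w' : Sym2 V → ℕ} {a b c : V} (hw : w s(a, b) = w' s(a, c)) :
    edgeMonomial K w s(a, b) - edgeMonomial K w' s(a, c) ∈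
      Ideal.span {(MvPolynomial.X b - MvPolynomial.X c : MvPolynomial V K)} := by
  rw [Ideal.mem_span_singleton]
  simp only [edgeMonomial, Sym2.lift_mk, hw]
  refine dvd_trans ?_ (sub_dvd_pow_sub_pow _ _ _)
  rw [← mul_sub]
  exact dvd_mul_left _ _

/-- The edge ideals of `G` and `O_i(G)` agree modulo `x_i - y_i`. -/
theorem weightedEdgeIdeal_sup_eq_Ograph {h : ℕ} (K : Type*) [CommRing K]
    {G : SimpleGraph (Fin h ⊕ Fin h)} (hG : IsVeryWellCovered G)
    (hadj : ∀ i : Fin h, G.Adj (Sum.inl i) (Sum.inr i))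
    (w : Sym2 (Fin h ⊕ Fin h) → ℕ) (i : Fin h) :
    weightedEdgeIdeal K G w ⊔
        Ideal.span {MvPolynomial.X (Sum.inl i) - MvPolynomial.X (Sum.inr i)} =
      weightedEdgeIdeal K (Ograph G i) (Oweight G w i) ⊔
        Ideal.span {MvPolynomial.X (Sum.inl i) - MvPolynomial.X (Sum.inr i)} := by
  have hsub (m : Fin h) (hm : m ∈ Nset G i) :=
    edgeMonomial_sub_edgeMonomial_mem K (Oweight_of_mem w hm)
  apply le_antisymm <;> refine sup_le (Ideal.span_le.2 ?_) le_sup_right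
  · rintro _ ⟨e, he, rfl⟩
    by_cases hN : ∃ m ∈ Nset G i, e = s(Sum.inl m, Sum.inr i)
    · obtain ⟨m, hm, rfl⟩ := hN
      rw [SetLike.mem_coe, ← sub_sub_cancel (edgeMonomial K (Oweight G w i) _)
        (edgeMonomial K w s(Sum.inl m, Sum.inr i))]
      refine sub_mem (Ideal.mem_sup_left (Ideal.subset_span ⟨_, ?_, rfl⟩))
        (Ideal.mem_sup_right (hsub m hm))
      exact mem_edgeSet_Ograph.2 (Or.inr ⟨m, hm, rfl⟩)
    · refine Ideal.mem_sup_left (Ideal.subset_span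
        ⟨e, mem_edgeSet_Ograph.2 (Or.inl ⟨he, hN⟩), ?_⟩)
      rw [edgeMonomial, edgeMonomial, Oweight_of_mem_edgeSet hG hadj w i he]
  · rintro _ ⟨e, he, rfl⟩
    rcases mem_edgeSet_Ograph.1 he with ⟨he, -⟩ | ⟨m, hm, rfl⟩
    · refine Ideal.mem_sup_left (Ideal.subset_span ⟨e, he, ?_⟩)
      rw [edgeMonomial, edgeMonomial, Oweight_of_mem_edgeSet hG hadj w i he]
    · rw [SetLike.mem_coe, ← sub_add_cancel (edgeMonomial K (Oweight G w i) _)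
        (edgeMonomial K w s(Sum.inl m, Sum.inr i))]
      exact add_mem (Ideal.mem_sup_right (hsub m hm))
        (Ideal.mem_sup_left (Ideal.subset_span ⟨_, hm.1, rfl⟩))

/-- For a very well-covered graph `G` with `2h` vertices labeled so that condition (*)
holds and an edge weight `w`, for every `k` there is a ring isomorphism
`(S ⧸ I(G_w)) ⧸ (x_k - y_k) ≃ (S ⧸ I(O_k(G_w))) ⧸ (x_k - y_k)`. -/
theorem quotient_iso_Ograph {h : ℕ} (K : Type*) [Field K]
    (G : SimpleGraph (Fin h ⊕ Fin h)) (hvwc : IsVeryWellCovered G) (hstar : CondStar G)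
    (w : Sym2 (Fin h ⊕ Fin h) → ℕ) (hw : ∀ e ∈ G.edgeSet, 0 < w e) (k : Fin h) :
    Nonempty
      (((MvPolynomial (Fin h ⊕ Fin h) K ⧸ weightedEdgeIdeal K G w) ⧸
          Ideal.span {Ideal.Quotient.mk (weightedEdgeIdeal K G w)
            (MvPolynomial.X (Sum.inl k) - MvPolynomial.X (Sum.inr k))}) ≃+*
        ((MvPolynomial (Fin h ⊕ Fin h) K ⧸
            weightedEdgeIdeal K (Ograph G k) (Oweight G w k)) ⧸
          Ideal.span {Ideal.Quotient.mk (weightedEdgeIdeal K (Ograph G k) (Oweight G w k))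
            (MvPolynomial.X (Sum.inl k) - MvPolynomial.X (Sum.inr k))})) := by
  have hmap (I : Ideal (MvPolynomial (Fin h ⊕ Fin h) K)) (f : MvPolynomial (Fin h ⊕ Fin h) K) :
      Ideal.span {Ideal.Quotient.mk I f} = (Ideal.span {f}).map (Ideal.Quotient.mk I) := by
    rw [Ideal.map_span, Set.image_singleton]
  rw [hmap, hmap]
  exact ⟨(DoubleQuot.quotQuotEquivQuotSup _ _).trans
    ((Ideal.quotEquivOfEq (weightedEdgeIdeal_sup_eq_Ograph K hvwc hstar.2.2 w k)).trans
      (DoubleQuot.quotQuotEquivQuotSup _ _).symm)⟩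
end
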